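/- arXiv:1802.09637 — 4 statements merged into one kernel-verified Lean document; each statement's English description precedes it below -/
import Mathlib

section
/- Let λ = 1/√5. There exists a continuous curve γ : [0,∞) → ℝ³ whose image is contained in the closed unit ball of ℝ³, which has a nonzero right derivative γ'(τ) at every τ ≥ 0, which satisfies the λ-cone property ⟨γ'(τ), γ(t) − γ(τ)⟩ ≤ λ‖γ'(τ)‖‖γ(t) − γ(τ)‖ for all 0 ≤ t < τ, whose length is infinite (ℓ(γ) = ∞), and such that lim_{t→∞} γ(t) exists. -/
open scoped RealInnerProductSpace
open Set Filter

section Glue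

/-- Concatenation of countably many curves, each parametrised by `[0, 1]`. -/
noncomputable def glue {E : Type*} (f : ℕ → ℝ → E) (t : ℝ) : E := f ⌊t⌋₊ (t - ⌊t⌋₊)

theorem glue_of_mem_Ico {E : Type*} (f : ℕ → ℝ → E) {n : ℕ} {t : ℝ} (ht : t ∈ Ico (n : ℝ) (n + 1)) :
    glue f t = f n (t - n) := by
  have : ⌊t⌋₊ = n := (Nat.floor_eq_iff (n.cast_nonneg.trans ht.1)).2 ht
  simp [glue, this]

theorem glue_of_mem_Icc {E : Type*} {f : ℕ → ℝ → E} {n : ℕ} (h : f n 1 = f (n + 1) 0) {t : ℝ}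
    (ht : t ∈ Icc (n : ℝ) (n + 1)) : glue f t = f n (t - n) := by
  rcases ht.2.lt_or_eq with h1 | h1
  · exact glue_of_mem_Ico f ⟨ht.1, h1⟩
  · rw [glue_of_mem_Ico f (n := n + 1) (by subst h1; constructor <;> push_cast <;> linarith), h1]
    simp [h]

variable {V : Type*} [NormedAddCommGroup V] [InnerProductSpace ℝ V]

/-- The cone inequality with `λ = 1 / √5` for the direction `d` and the displacement `y`. -/
def ConeBound (d y : V) : Prop := ⟪d, y⟫ ≤ 1 / Real.sqrt 5 * ‖d‖ * ‖y‖

/-- A curve on `[0, 1]` with a right derivative and the cone property. -/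
structure IsConeArc (f f' : ℝ → V) : Prop where
  continuousOn : ContinuousOn f (Icc 0 1)
  hasDeriv : ∀ t ∈ Ico (0 : ℝ) 1, HasDerivWithinAt f (f' t) (Ici t) t
  ne_zero : ∀ t ∈ Ico (0 : ℝ) 1, f' t ≠ 0
  cone : ∀ s t : ℝ, 0 ≤ s → s < t → t < 1 → ConeBound (f' t) (f s - f t)

/-- A curve on `[0, ∞)` with a right derivative and the cone property. -/
structure IsConeCurve (γ γ' : ℝ → V) : Prop where
  continuousOn : ContinuousOn γ (Ici 0)
  hasDeriv : ∀ t : ℝ, 0 ≤ t → HasDerivWithinAt γ (γ' t) (Ici t) t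
  ne_zero : ∀ t : ℝ, 0 ≤ t → γ' t ≠ 0
  cone : ∀ s t : ℝ, 0 ≤ s → s < t → ConeBound (γ' t) (γ s - γ t)

omit [InnerProductSpace ℝ V] in
theorem continuousOn_glue {f : ℕ → ℝ → V} (hf : ∀ n, ContinuousOn (f n) (Icc 0 1))
    (h : ∀ n, f n 1 = f (n + 1) 0) : ContinuousOn (glue f) (Ici 0) := by
  have piece (n : ℕ) : ContinuousOn (glue f) (Icc (n : ℝ) (n + 1)) := by
    refine ContinuousOn.congr (f := fun t => f n (t - n)) ?_ fun t ht => glue_of_mem_Icc (h n) ht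
    refine (hf n).comp (by fun_prop) fun t ht => ?_
    constructor <;> linarith [ht.1, ht.2]
  have upto (n : ℕ) : ContinuousOn (glue f) (Icc 0 (n : ℝ)) := by
    induction n with
    | zero => simp
    | succ n ih =>
      have := ih.union_of_isClosed (piece n) isClosed_Icc isClosed_Icc
      rw [Icc_union_Icc_eq_Icc n.cast_nonneg (by linarith)] at this
      exact_mod_cast this
  intro t ht
  have h1 : t < (⌊t⌋₊ + 1 : ℕ) := by push_cast; exact Nat.lt_floor_add_one t
  refine (upto _ t ⟨ht, h1.le⟩).mono_of_mem_nhdsWithin ?_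
  filter_upwards [self_mem_nhdsWithin, mem_nhdsWithin_of_mem_nhds (Iio_mem_nhds h1)] with s hs hs'
  exact ⟨hs, le_of_lt hs'⟩

theorem hasDerivWithinAt_glue {f f' : ℕ → ℝ → V}
    (hf : ∀ n, ∀ t ∈ Ico (0 : ℝ) 1, HasDerivWithinAt (f n) (f' n t) (Ici t) t) {t : ℝ}
    (ht : 0 ≤ t) : HasDerivWithinAt (glue f) (glue f' t) (Ici t) t := by
  have h0 := Nat.floor_le ht
  have h1 := Nat.lt_floor_add_one t
  have hd := hf ⌊t⌋₊ (t - ⌊t⌋₊) ⟨by linarith, by linarith⟩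
  have hc : HasDerivWithinAt (fun s => f ⌊t⌋₊ (s - ⌊t⌋₊)) (glue f' t) (Ici t) t := by
    have hs := ((hasDerivAt_id t).sub_const (⌊t⌋₊ : ℝ)).hasDerivWithinAt (s := Ici t)
    have := HasDerivWithinAt.scomp t hd hs fun s hs => by
      simp only [mem_Ici, id] at hs ⊢; linarith
    simpa [glue, Function.comp_def] using this
  refine hc.congr_of_eventuallyEq ?_ rfl
  filter_upwards [self_mem_nhdsWithin, mem_nhdsWithin_of_mem_nhds (Iio_mem_nhds h1)] with s hs hs'
  exact glue_of_mem_Ico f ⟨h0.trans hs, hs'⟩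

theorem isConeCurve_glue {f f' : ℕ → ℝ → V} (hf : ∀ n, IsConeArc (f n) (f' n))
    (h : ∀ n, f n 1 = f (n + 1) 0)
    (hc : ∀ m n, m < n → ∀ s ∈ Ico (0 : ℝ) 1, ∀ t ∈ Ico (0 : ℝ) 1,
      ConeBound (f' n t) (f m s - f n t)) :
    IsConeCurve (glue f) (glue f') where
  continuousOn := continuousOn_glue (fun n => (hf n).continuousOn) h
  hasDeriv t ht := hasDerivWithinAt_glue (fun n => (hf n).hasDeriv) ht
  ne_zero t ht := (hf _).ne_zero _
    ⟨by linarith [Nat.floor_le ht], by linarith [Nat.lt_floor_add_one t]⟩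
  cone s t hs hst := by
    have ht := hs.trans hst.le
    have hs0 := Nat.floor_le hs
    have hs1 := Nat.lt_floor_add_one s
    have ht0 := Nat.floor_le ht
    have ht1 := Nat.lt_floor_add_one t
    rcases (Nat.floor_mono hst.le : ⌊s⌋₊ ≤ ⌊t⌋₊).lt_or_eq with hlt | heq
    · exact hc _ _ hlt _ ⟨by linarith, by linarith⟩ _ ⟨by linarith, by linarith⟩
    · simp only [glue]
      rw [heq] at hs0 hs1 ⊢
      exact (hf _).cone _ _ (by linarith) (by linarith) (by linarith)

theorem ConeBound.of_inner_nonpos {d y : V} (h : ⟪d, y⟫ ≤ 0) : ConeBound d y :=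
  h.trans (by positivity)

theorem ConeBound.of_sq_le {d y : V} {v : ℝ} (h : ⟪d, y⟫ ≤ v)
    (hv : 5 * v ^ 2 ≤ ‖d‖ ^ 2 * ‖y‖ ^ 2) : ConeBound d y := by
  refine h.trans ?_
  rw [mul_assoc, one_div, inv_mul_eq_div, le_div_iff₀ (by positivity)]
  refine (le_abs_self _).trans (abs_le_of_sq_le_sq ?_ (by positivity))
  rw [mul_pow, Real.sq_sqrt (by norm_num)]
  linarith [mul_pow ‖d‖ ‖y‖ 2]

theorem ConeBound.smul {d y : V} (h : ConeBound d y) {a b : ℝ} (ha : 0 ≤ a) (hb : 0 ≤ b) :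
    ConeBound (a • d) (b • y) := by
  unfold ConeBound at *
  rw [inner_smul_left, inner_smul_right, norm_smul, norm_smul, Real.norm_of_nonneg ha,
    Real.norm_of_nonneg hb]
  have := mul_le_mul_of_nonneg_left h (mul_nonneg ha hb)
  simp only [conj_trivial]
  linarith

theorem IsConeCurve.isConeArc {γ γ' : ℝ → V} (h : IsConeCurve γ γ') (o : V) {ε T : ℝ}
    (hε : 0 < ε) (hT : 0 < T) :
    IsConeArc (fun s => o + ε • γ (T * s)) (fun s => (ε * T) • γ' (T * s)) where
  continuousOn := by
    refine continuousOn_const.add (continuousOn_const.smul (h.continuousOn.comp (by fun_prop) ?_))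
    exact fun s hs => mul_nonneg hT.le hs.1
  hasDeriv t ht := by
    have hs := ((hasDerivAt_id t).const_mul T).hasDerivWithinAt (s := Ici t)
    have := HasDerivWithinAt.scomp t (h.hasDeriv _ (mul_nonneg hT.le ht.1)) hs fun s hs => by
      simp only [mem_Ici] at hs ⊢; exact mul_le_mul_of_nonneg_left hs hT.le
    have := (this.const_smul ε).const_add o
    simpa [Function.comp_def, smul_smul] using this
  ne_zero t ht := smul_ne_zero (by positivity) (h.ne_zero _ (mul_nonneg hT.le ht.1))
  cone s t hs hst _ := by
    have := (h.cone (T * s) (T * t) (by positivity) (by gcongr)).smul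
      (a := ε * T) (b := ε) (by positivity) hε.le
    convert this using 1
    module

end Glue

section Geometry

/-- The points of `ℝ × ℂ` with the Euclidean norm: a height and a lateral position. -/
abbrev Cyl : Type := WithLp 2 (ℝ × ℂ)

/-- The point of height `h` and lateral position `z`. -/
def cyl (h : ℝ) (z : ℂ) : Cyl := WithLp.toLp 2 (h, z)

/-- The unit complex number of argument `θ`. -/
noncomputable def cis (θ : ℝ) : ℂ := Complex.exp (θ * Complex.I)

/-- The ratio of the tangential to the vertical speed on the helices. -/
noncomputable def pitch : ℝ := 81 / 40

@[simp] theorem cyl_fst (h : ℝ) (z : ℂ) : (cyl h z).fst = h := rfl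

@[simp] theorem cyl_snd (h : ℝ) (z : ℂ) : (cyl h z).snd = z := rfl

theorem inner_cyl (h : ℝ) (z : ℂ) (y : Cyl) : ⟪cyl h z, y⟫ = h * y.fst + ⟪z, y.snd⟫ := by
  rw [WithLp.prod_inner_apply]
  simp [cyl, mul_comm]

theorem norm_cyl_sq (h : ℝ) (z : ℂ) : ‖cyl h z‖ ^ 2 = h ^ 2 + ‖z‖ ^ 2 := by
  rw [WithLp.prod_norm_sq_eq_of_L2]
  simp

@[simp] theorem norm_cis (θ : ℝ) : ‖cis θ‖ = 1 := Complex.norm_exp_ofReal_mul_I θ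

theorem inner_I_mul_cis (α β : ℝ) : ⟪Complex.I * cis α, cis β⟫ = Real.sin (β - α) := by
  rw [Complex.inner, Real.sin_sub]
  simp only [cis, Complex.mul_re, Complex.conj_re, Complex.mul_im, Complex.conj_im,
    Complex.I_re, Complex.I_im, Complex.exp_ofReal_mul_I_re, Complex.exp_ofReal_mul_I_im]
  ring

theorem inner_I_mul_self (u : ℂ) : ⟪Complex.I * u, u⟫ = 0 := by
  rw [Complex.inner]
  simp only [Complex.mul_re, Complex.conj_re, Complex.mul_im, Complex.conj_im,
    Complex.I_re, Complex.I_im]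
  ring

theorem coneBound_vertical {c : ℝ} (hc : 0 ≤ c) {y : Cyl} (hy : y.fst ≤ 0) :
    ConeBound (cyl c 0) y := by
  refine .of_inner_nonpos ?_
  rw [inner_cyl]
  simpa using mul_nonpos_of_nonneg_of_nonpos hc hy

theorem coneBound_radial {u : ℂ} (hu : ‖u‖ = 1) {c a : ℝ} (hc : 0 ≤ c) (h : ℝ) {p : Cyl}
    (hp : ‖p.snd‖ ≤ a) : ConeBound (cyl 0 (c • u)) (p - cyl h (a • u)) := by
  refine .of_inner_nonpos ?_
  have := real_inner_le_norm u p.snd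
  rw [hu, one_mul] at this
  rw [inner_cyl, WithLp.sub_snd, cyl_snd, inner_smul_left, inner_sub_right, inner_smul_right,
    real_inner_self_eq_norm_sq, hu]
  simp only [conj_trivial, zero_mul, zero_add]
  exact mul_nonpos_of_nonneg_of_nonpos hc (by linarith)

theorem inner_helix (σ h R : ℝ) (u : ℂ) (p : Cyl) :
    ⟪cyl σ (pitch • (Complex.I * u)), p - cyl h (R • u)⟫ =
      σ * (p.fst - h) + pitch * ⟪Complex.I * u, p.snd⟫ := by
  rw [inner_cyl, WithLp.sub_snd, WithLp.sub_fst, cyl_snd, cyl_fst, inner_smul_left,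
    inner_sub_right, inner_smul_right, inner_I_mul_self]
  simp

theorem norm_sq_helix {σ : ℝ} (hσ : σ ^ 2 = 1) {u : ℂ} (hu : ‖u‖ = 1) :
    ‖cyl σ (pitch • (Complex.I * u))‖ ^ 2 = 1 + pitch ^ 2 := by
  rw [norm_cyl_sq, hσ, norm_smul, norm_mul, hu]
  simp

theorem coneBound_helix_of_small {u : ℂ} (hu : ‖u‖ = 1) {σ : ℝ} (hσ : σ ^ 2 = 1) (h : ℝ)
    {r R : ℝ} {p : Cyl} (hp : ‖p.snd‖ ≤ r) (hR : 20 * r ≤ R) :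
    ConeBound (cyl σ (pitch • (Complex.I * u))) (p - cyl h (R • u)) := by
  have hr : 0 ≤ r := (norm_nonneg _).trans hp
  have hin := real_inner_le_norm (Complex.I * u) p.snd
  rw [norm_mul, hu, Complex.norm_I, one_mul, one_mul] at hin
  refine ConeBound.of_sq_le (v := |p.fst - h| + pitch * r) ?_ ?_
  · rw [inner_helix]
    have h1 : σ * (p.fst - h) ≤ |p.fst - h| := by
      refine (le_abs_self _).trans ?_
      rw [abs_mul, (pow_eq_one_iff_of_nonneg (abs_nonneg σ) two_ne_zero).1 (by rwa [sq_abs]),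
        one_mul]
    unfold pitch
    linarith
  · rw [norm_sq_helix hσ hu, WithLp.prod_norm_sq_eq_of_L2, WithLp.sub_fst, WithLp.sub_snd,
      cyl_fst, cyl_snd, Real.norm_eq_abs]
    have h2 : 19 * r ≤ ‖p.snd - R • u‖ := by
      have := norm_sub_norm_le (R • u) p.snd
      rw [norm_smul, hu, Real.norm_of_nonneg (by linarith), norm_sub_rev] at this
      linarith
    have h3 : (19 * r) ^ 2 ≤ ‖p.snd - R • u‖ ^ 2 := by gcongr
    unfold pitch
    nlinarith [sq_nonneg (|p.fst - h| - 100 * r), sq_nonneg (|p.fst - h|), sq_nonneg r]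

theorem add_sin_nonneg {φ s : ℝ} (hφ : 0 ≤ φ) (hs0 : 0 ≤ s) (hs1 : s ≤ 1) :
    0 ≤ φ + pitch ^ 2 * (s * Real.sin φ) := by
  have hp : pitch ^ 2 = 6561 / 1600 := by norm_num [pitch]
  rw [hp]
  rcases le_total φ Real.pi with h1 | h1
  · have := mul_nonneg hs0 (Real.sin_nonneg_of_nonneg_of_le_pi hφ h1)
    linarith
  · rcases le_total φ (6561 / 1600) with h2 | h2
    · have h3 := Real.sin_le (sub_nonneg.2 h1)
      rw [Real.sin_sub_pi] at h3
      nlinarith [Real.pi_gt_d2, mul_le_mul_of_nonneg_right hs1 (sub_nonneg.2 h1)]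
    · nlinarith [Real.neg_one_le_sin φ]

theorem coneBound_helix_of_trail {σ : ℝ} (hσ : σ ^ 2 = 1) {R φ s : ℝ} (hR : 0 ≤ R)
    (hφ : 0 ≤ φ) (hs0 : 0 ≤ s) (hs1 : s ≤ 1) (θ h : ℝ) :
    ConeBound (cyl σ (pitch • (Complex.I * cis θ)))
      (cyl (h - σ * (R * φ / pitch)) ((s * R) • cis (θ - φ)) - cyl h (R • cis θ)) := by
  refine .of_inner_nonpos ?_
  rw [inner_helix, cyl_fst, cyl_snd, inner_smul_right, inner_I_mul_cis]
  have := mul_nonneg hR (add_sin_nonneg hφ hs0 hs1)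
  have e : θ - φ - θ = -φ := by ring
  have e2 : σ * (h - σ * (R * φ / pitch) - h) = - (R * φ / pitch) := by
    linear_combination (- (R * φ / pitch)) * hσ
  rw [e, Real.sin_neg, e2]
  unfold pitch at *
  linarith

theorem coneBound_helix_of_below {u : ℂ} (hu : ‖u‖ = 1) {σ : ℝ} (hσ : σ ^ 2 = 1) {h : ℝ}
    (hh : 1 ≤ h) (R : ℝ) {p : Cyl} (hp0 : p.fst ≤ 0) (hp : ‖p.snd‖ ≤ 1 / 500 * (1 - p.fst)) :
    ConeBound (cyl σ (pitch • (Complex.I * u))) (p - cyl h (R • u)) := by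
  have hin := real_inner_le_norm (Complex.I * u) p.snd
  rw [norm_mul, hu, Complex.norm_I, one_mul, one_mul] at hin
  refine ConeBound.of_sq_le (v := (1 + pitch / 500) * (h - p.fst)) ?_ ?_
  · rw [inner_helix]
    have h1 : σ * (p.fst - h) ≤ h - p.fst := by
      rcases eq_or_eq_neg_of_sq_eq_sq σ 1 (by simpa using hσ) with rfl | rfl <;> linarith
    unfold pitch
    linarith
  · rw [norm_sq_helix hσ hu, WithLp.prod_norm_sq_eq_of_L2, WithLp.sub_fst, cyl_fst,
      Real.norm_eq_abs, sq_abs]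
    unfold pitch
    nlinarith [sq_nonneg (h - p.fst), sq_nonneg ‖(p - cyl h (R • u)).snd‖]

theorem coneBound_radial_of_below {u : ℂ} (hu : ‖u‖ = 1) {c h R : ℝ} (hc : 0 ≤ c) (hh : 1 ≤ h)
    (hR : 0 ≤ R) {p : Cyl}
    (hp : ‖p.snd‖ ≤ 1 / 500 * (1 - p.fst)) : ConeBound (cyl 0 (c • u)) (p - cyl h (R • u)) := by
  have hin := real_inner_le_norm u p.snd
  rw [hu, one_mul] at hin
  refine ConeBound.of_sq_le (v := c * (1 / 500 * (h - p.fst))) ?_ ?_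
  · rw [inner_cyl, WithLp.sub_snd, cyl_snd, inner_smul_left, inner_sub_right, inner_smul_right,
      real_inner_self_eq_norm_sq, hu]
    simp only [conj_trivial, zero_mul, zero_add]
    gcongr
    linarith
  · rw [norm_cyl_sq, norm_smul, hu, WithLp.prod_norm_sq_eq_of_L2, WithLp.sub_fst, cyl_fst,
      Real.norm_eq_abs, Real.norm_eq_abs, mul_one, sq_abs, sq_abs, mul_pow]
    nlinarith [mul_nonneg (sq_nonneg c) (sq_nonneg (h - p.fst)),
      mul_nonneg (sq_nonneg c) (sq_nonneg ‖(p - cyl h (R • u)).snd‖)]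

end Geometry

section Block

theorem hasDerivAt_cyl {a : ℝ → ℝ} {z : ℝ → ℂ} {a' : ℝ} {z' : ℂ} {t : ℝ}
    (ha : HasDerivAt a a' t) (hz : HasDerivAt z z' t) :
    HasDerivAt (fun t => cyl (a t) (z t)) (cyl a' z') t :=
  (WithLp.prodContinuousLinearEquiv 2 ℝ ℝ ℂ).symm.toContinuousLinearMap.hasFDerivAt.comp_hasDerivAt
    t (ha.prodMk hz)

theorem hasDerivAt_cis {a : ℝ → ℝ} {a' t : ℝ} (ha : HasDerivAt a a' t) :
    HasDerivAt (fun t => cis (a t)) (a' • (Complex.I * cis (a t))) t := by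
  have h : a' • (Complex.I * cis (a t)) =
      Complex.exp (a t * Complex.I) * (a' * Complex.I) := by
    rw [cis, Complex.real_smul]
    ring
  rw [h]
  exact (ha.ofReal_comp.mul_const Complex.I).cexp

/-- The radii of the helices of a block. -/
noncomputable def radius (ρ : ℝ) : ℕ → ℝ
  | 0 => 0
  | k + 1 => ρ * 20 ^ k

/-- The argument at which the `k`-th helix of a block starts. -/
noncomputable def angle (ρ : ℝ) (k : ℕ) : ℝ :=
  ∑ i ∈ Finset.range k, pitch / radius ρ (i + 1)

/-- The height at which the `k`-th helix of a block starts. -/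
noncomputable def level (k : ℕ) : ℝ := 3 / 2 + (-1) ^ k / 2

/-- The vertical speed along the `k`-th helix of a block. -/
noncomputable def climb (k : ℕ) : ℝ := -(-1) ^ k

/-- The horizontal segment leading to the `k`-th helix. -/
noncomputable def radialArc (ρ : ℝ) (k : ℕ) (t : ℝ) : Cyl :=
  cyl (level k) ((radius ρ k + t * (radius ρ (k + 1) - radius ρ k)) • cis (angle ρ k))

/-- The `k`-th helix. -/
noncomputable def helixArc (ρ : ℝ) (k : ℕ) (t : ℝ) : Cyl :=
  cyl (level k + climb k * t)
    (radius ρ (k + 1) • cis (angle ρ k + t * (pitch / radius ρ (k + 1))))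

/-- The consecutive pieces of a block. -/
noncomputable def piece (ρ : ℝ) : ℕ → ℝ → Cyl
  | 0 => fun t => cyl (2 * t) 0
  | n + 1 => if Even n then radialArc ρ (n / 2) else helixArc ρ (n / 2)

/-- The derivatives of the pieces of a block. -/
noncomputable def pieceDeriv (ρ : ℝ) : ℕ → ℝ → Cyl
  | 0 => fun _ => cyl 2 0
  | n + 1 =>
    if Even n then fun _ =>
      cyl 0 ((radius ρ (n / 2 + 1) - radius ρ (n / 2)) • cis (angle ρ (n / 2)))
    else fun t => cyl (climb (n / 2))
      (pitch • (Complex.I * cis (angle ρ (n / 2) + t * (pitch / radius ρ (n / 2 + 1)))))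

theorem piece_odd (ρ : ℝ) (k : ℕ) : piece ρ (2 * k + 1) = radialArc ρ k := by
  simp [piece]

theorem piece_even (ρ : ℝ) (k : ℕ) : piece ρ (2 * k + 2) = helixArc ρ k := by
  have : (2 * k + 1) / 2 = k := by omega
  simp [piece, this]

theorem pieceDeriv_odd (ρ : ℝ) (k : ℕ) : pieceDeriv ρ (2 * k + 1) =
    fun _ => cyl 0 ((radius ρ (k + 1) - radius ρ k) • cis (angle ρ k)) := by
  simp [pieceDeriv]

theorem pieceDeriv_even (ρ : ℝ) (k : ℕ) : pieceDeriv ρ (2 * k + 2) =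
    fun t => cyl (climb k)
      (pitch • (Complex.I * cis (angle ρ k + t * (pitch / radius ρ (k + 1))))) := by
  have : (2 * k + 1) / 2 = k := by omega
  simp [pieceDeriv, this]

theorem piece_cases (n : ℕ) : n = 0 ∨ (∃ k, n = 2 * k + 1) ∨ ∃ k, n = 2 * k + 2 := by
  rcases Nat.even_or_odd' n with ⟨k, rfl | rfl⟩
  · rcases k with _ | k
    · exact .inl rfl
    · exact .inr (.inr ⟨k, by ring⟩)
  · exact .inr (.inl ⟨k, rfl⟩)

theorem climb_sq (k : ℕ) : climb k ^ 2 = 1 := by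
  rw [climb, neg_sq, ← pow_mul, mul_comm, pow_mul]
  simp

theorem level_succ (k : ℕ) : level (k + 1) = level k + climb k := by
  simp only [level, climb, pow_succ]
  ring

theorem level_mem (k : ℕ) : level k ∈ Icc (1 : ℝ) 2 := by
  unfold level
  rcases neg_one_pow_eq_or ℝ k with h | h <;> rw [h] <;> norm_num

variable {ρ : ℝ}

theorem radius_nonneg (hρ : 0 < ρ) : ∀ k, 0 ≤ radius ρ k
  | 0 => le_rfl
  | _ + 1 => by simp only [radius]; positivity

theorem radius_succ_pos (hρ : 0 < ρ) (k : ℕ) : 0 < radius ρ (k + 1) := by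
  simp only [radius]; positivity

theorem twenty_mul_radius_le (hρ : 0 < ρ) : ∀ k, 20 * radius ρ k ≤ radius ρ (k + 1)
  | 0 => by simp [radius, hρ.le]
  | k + 1 => by simp only [radius, pow_succ]; linarith

theorem radius_lt_succ (hρ : 0 < ρ) (k : ℕ) : radius ρ k < radius ρ (k + 1) := by
  linarith [radius_nonneg hρ k, radius_succ_pos hρ k, twenty_mul_radius_le hρ k]

theorem radius_mono (hρ : 0 < ρ) : Monotone (radius ρ) :=
  monotone_nat_of_le_succ fun k => (radius_lt_succ hρ k).le

theorem radialArc_radius_mem (hρ : 0 < ρ) (k : ℕ) {t : ℝ} (ht : t ∈ Icc (0 : ℝ) 1) :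
    radius ρ k + t * (radius ρ (k + 1) - radius ρ k) ∈ Icc (radius ρ k) (radius ρ (k + 1)) := by
  have := sub_pos.2 (radius_lt_succ hρ k)
  constructor <;> nlinarith [ht.1, ht.2]

theorem hasDerivAt_piece (hρ : 0 < ρ) (n : ℕ) (t : ℝ) :
    HasDerivAt (piece ρ n) (pieceDeriv ρ n t) t := by
  rcases piece_cases n with rfl | ⟨k, rfl⟩ | ⟨k, rfl⟩
  · exact hasDerivAt_cyl (by simpa using (hasDerivAt_id t).const_mul 2) (hasDerivAt_const _ _)
  · rw [piece_odd, pieceDeriv_odd]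
    refine hasDerivAt_cyl (hasDerivAt_const _ _) (HasDerivAt.smul_const ?_ _)
    simpa using ((hasDerivAt_id t).mul_const (radius ρ (k + 1) - radius ρ k)).const_add (radius ρ k)
  · rw [piece_even, pieceDeriv_even]
    refine hasDerivAt_cyl ?_ ?_
    · simpa using ((hasDerivAt_id t).const_mul (climb k)).const_add (level k)
    · have h := ((hasDerivAt_id t).mul_const (pitch / radius ρ (k + 1))).const_add (angle ρ k)
      have := (hasDerivAt_cis h).const_smul (radius ρ (k + 1))
      rwa [one_mul, smul_smul, mul_div_cancel₀ _ (radius_succ_pos hρ k).ne'] at this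

theorem cyl_ne_zero {h : ℝ} {z : ℂ} (hz : h ≠ 0 ∨ z ≠ 0) : cyl h z ≠ 0 := by
  intro h0
  have := norm_cyl_sq h z
  rw [h0] at this
  rcases hz with h1 | h1
  · have : 0 < h ^ 2 := by positivity
    nlinarith [sq_nonneg ‖z‖, norm_zero (E := Cyl)]
  · have : 0 < ‖z‖ ^ 2 := by positivity
    nlinarith [sq_nonneg h, norm_zero (E := Cyl)]

theorem pieceDeriv_ne_zero (hρ : 0 < ρ) (n : ℕ) (t : ℝ) : pieceDeriv ρ n t ≠ 0 := by
  rcases piece_cases n with rfl | ⟨k, rfl⟩ | ⟨k, rfl⟩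
  · exact cyl_ne_zero (.inl two_ne_zero)
  · rw [pieceDeriv_odd]
    refine cyl_ne_zero (.inr (smul_ne_zero (sub_pos.2 (radius_lt_succ hρ k)).ne' ?_))
    simp [← norm_ne_zero_iff]
  · rw [pieceDeriv_even]
    exact cyl_ne_zero (.inl fun h => by simpa [h] using climb_sq k)

theorem piece_one (ρ : ℝ) (n : ℕ) : piece ρ n 1 = piece ρ (n + 1) 0 := by
  rcases piece_cases n with rfl | ⟨k, rfl⟩ | ⟨k, rfl⟩
  · rw [piece_odd ρ 0]
    norm_num [piece, radialArc, level, radius]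
  · rw [piece_odd, piece_even]
    simp [radialArc, helixArc]
  · rw [piece_even, show 2 * k + 2 + 1 = 2 * (k + 1) + 1 by ring, piece_odd]
    simp [radialArc, helixArc, level_succ, angle, Finset.sum_range_succ]

theorem norm_snd_piece_le (hρ : 0 < ρ) {n k : ℕ} (hn : n ≤ 2 * k) {t : ℝ}
    (ht : t ∈ Icc (0 : ℝ) 1) : ‖(piece ρ n t).snd‖ ≤ radius ρ k := by
  rcases piece_cases n with rfl | ⟨j, rfl⟩ | ⟨j, rfl⟩
  · simpa [piece] using radius_nonneg hρ k
  · have := radialArc_radius_mem hρ j ht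
    rw [piece_odd, radialArc, cyl_snd, norm_smul, norm_cis, mul_one,
      Real.norm_of_nonneg ((radius_nonneg hρ j).trans this.1)]
    exact this.2.trans (radius_mono hρ (by omega))
  · rw [piece_even, helixArc, cyl_snd, norm_smul, norm_cis, mul_one,
      Real.norm_of_nonneg (radius_nonneg hρ _)]
    exact radius_mono hρ (by omega)

theorem fst_piece_succ_mem (ρ : ℝ) (n : ℕ) {t : ℝ} (ht : t ∈ Icc (0 : ℝ) 1) :
    (piece ρ (n + 1) t).fst ∈ Icc (1 : ℝ) 2 := by
  rcases piece_cases (n + 1) with h | ⟨k, h⟩ | ⟨k, h⟩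
  · simp at h
  · rw [h, piece_odd]
    exact level_mem k
  · rw [h, piece_even, helixArc, cyl_fst]
    have h0 := level_mem k
    have h1 := level_mem (k + 1)
    rw [level_succ] at h1
    constructor <;> nlinarith [ht.1, ht.2, h0.1, h0.2, h1.1, h1.2]

theorem isConeArc_piece (hρ : 0 < ρ) (n : ℕ) : IsConeArc (piece ρ n) (pieceDeriv ρ n) where
  continuousOn t _ := (hasDerivAt_piece hρ n t).continuousAt.continuousWithinAt
  hasDeriv t _ := (hasDerivAt_piece hρ n t).hasDerivWithinAt
  ne_zero t _ := pieceDeriv_ne_zero hρ n t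
  cone s t hs hst ht := by
    rcases piece_cases n with rfl | ⟨k, rfl⟩ | ⟨k, rfl⟩
    · exact coneBound_vertical zero_le_two (by simp [piece]; linarith)
    · rw [piece_odd, pieceDeriv_odd]
      have := sub_pos.2 (radius_lt_succ hρ k)
      have h1 := (radialArc_radius_mem hρ k ⟨hs, (hst.trans ht).le⟩).1
      refine coneBound_radial (norm_cis _) this.le _ ?_
      rw [radialArc, cyl_snd, norm_smul, norm_cis, mul_one,
        Real.norm_of_nonneg ((radius_nonneg hρ k).trans h1)]
      gcongr
    · rw [piece_even, pieceDeriv_even]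
      have hR := radius_succ_pos hρ k
      have hp : 0 < pitch := by norm_num [pitch]
      have := coneBound_helix_of_trail (climb_sq k) (R := radius ρ (k + 1))
        (φ := (t - s) * (pitch / radius ρ (k + 1))) (s := 1) hR.le
        (mul_nonneg (by linarith) (by positivity)) zero_le_one le_rfl
        (angle ρ k + t * (pitch / radius ρ (k + 1))) (level k + climb k * t)
      convert this using 2
      swap
      · rfl
      unfold helixArc
      congr 1
      · field_simp
        ring
      · rw [one_mul]
        congr 2
        ring

theorem coneBound_piece (hρ : 0 < ρ) {m n : ℕ} (hmn : m < n) {s t : ℝ} (hs : s ∈ Icc (0 : ℝ) 1)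
    (ht : t ∈ Icc (0 : ℝ) 1) : ConeBound (pieceDeriv ρ n t) (piece ρ m s - piece ρ n t) := by
  rcases piece_cases n with rfl | ⟨k, rfl⟩ | ⟨k, rfl⟩
  · simp at hmn
  · rw [piece_odd, pieceDeriv_odd]
    exact coneBound_radial (norm_cis _) (sub_pos.2 (radius_lt_succ hρ k)).le _
      ((norm_snd_piece_le hρ (by omega) hs).trans (radialArc_radius_mem hρ k ht).1)
  · rw [piece_even, pieceDeriv_even]
    rcases (show m ≤ 2 * k ∨ m = 2 * k + 1 by omega) with h | rfl
    · exact coneBound_helix_of_small (norm_cis _) (climb_sq k) _ (norm_snd_piece_le hρ h hs)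
        (twenty_mul_radius_le hρ k)
    · have hR := radius_succ_pos hρ k
      have hp : 0 < pitch := by norm_num [pitch]
      have hr := radialArc_radius_mem hρ k hs
      have := coneBound_helix_of_trail (climb_sq k) (R := radius ρ (k + 1))
        (φ := t * (pitch / radius ρ (k + 1)))
        (s := (radius ρ k + s * (radius ρ (k + 1) - radius ρ k)) / radius ρ (k + 1)) hR.le
        (mul_nonneg ht.1 (by positivity))
        (div_nonneg ((radius_nonneg hρ k).trans hr.1) hR.le) ((div_le_one hR).2 hr.2)
        (angle ρ k + t * (pitch / radius ρ (k + 1))) (level k + climb k * t)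
      rw [piece_odd]
      convert this using 2
      swap
      · rfl
      unfold radialArc
      congr 1
      · field_simp
        ring
      · rw [div_mul_cancel₀ _ hR.ne']
        congr 2
        ring

theorem coneBound_piece_of_below (hρ : 0 < ρ) (n : ℕ) {t : ℝ} (ht : t ∈ Icc (0 : ℝ) 1) {p : Cyl}
    (hp0 : p.fst ≤ 0) (hp : ‖p.snd‖ ≤ 1 / 500 * (1 - p.fst)) :
    ConeBound (pieceDeriv ρ n t) (p - piece ρ n t) := by
  rcases piece_cases n with rfl | ⟨k, rfl⟩ | ⟨k, rfl⟩
  · refine coneBound_vertical zero_le_two ?_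
    simp only [piece, WithLp.sub_fst, cyl_fst]
    linarith [ht.1]
  · have := (fst_piece_succ_mem ρ (2 * k) ht).1
    rw [piece_odd] at this ⊢
    rw [pieceDeriv_odd]
    exact coneBound_radial_of_below (norm_cis _) (sub_pos.2 (radius_lt_succ hρ k)).le this
      ((radius_nonneg hρ k).trans (radialArc_radius_mem hρ k ht).1) hp
  · have := (fst_piece_succ_mem ρ (2 * k + 1) ht).1
    rw [piece_even] at this ⊢
    rw [pieceDeriv_even]
    exact coneBound_helix_of_below (norm_cis _) (climb_sq k) this _ hp0 hp

/-- A curve of height between `0` and `2` winding along helices of increasing radii. -/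
noncomputable def block (ρ : ℝ) : ℝ → Cyl := glue (piece ρ)

/-- The right derivative of `block`. -/
noncomputable def blockDeriv (ρ : ℝ) : ℝ → Cyl := glue (pieceDeriv ρ)

theorem isConeCurve_block (hρ : 0 < ρ) : IsConeCurve (block ρ) (blockDeriv ρ) :=
  isConeCurve_glue (isConeArc_piece hρ) (piece_one ρ) fun _ _ h _ hs _ ht =>
    coneBound_piece hρ h (Ico_subset_Icc_self hs) (Ico_subset_Icc_self ht)

theorem coneBound_block_of_below (hρ : 0 < ρ) {t : ℝ} (ht : 0 ≤ t) {p : Cyl}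
    (hp0 : p.fst ≤ 0) (hp : ‖p.snd‖ ≤ 1 / 500 * (1 - p.fst)) :
    ConeBound (blockDeriv ρ t) (p - block ρ t) :=
  coneBound_piece_of_below hρ _
    ⟨by linarith [Nat.floor_le ht], by linarith [Nat.lt_floor_add_one t]⟩ hp0 hp

theorem block_zero (ρ : ℝ) : block ρ 0 = 0 := by
  simp only [block, glue, Nat.floor_zero, piece, CharP.cast_eq_zero, sub_zero, mul_zero]
  rfl

theorem fst_block_odd (ρ : ℝ) (k : ℕ) : (block ρ (2 * k + 1)).fst = level k := by
  have : (2 * k + 1 : ℝ) ∈ Ico ((2 * k + 1 : ℕ) : ℝ) ((2 * k + 1 : ℕ) + 1) := by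
    constructor <;> push_cast <;> linarith
  rw [block, glue_of_mem_Ico _ this, piece_odd]
  rfl

theorem block_mem (hρ : 0 < ρ) (k : ℕ) {t : ℝ} (ht : t ∈ Icc (0 : ℝ) (2 * k + 1)) :
    (block ρ t).fst ∈ Icc (0 : ℝ) 2 ∧ ‖(block ρ t).snd‖ ≤ radius ρ k := by
  obtain ⟨n, hn, htn⟩ : ∃ n ≤ 2 * k, t ∈ Icc (n : ℝ) (n + 1) := by
    rcases ht.2.lt_or_eq with h | h
    · refine ⟨⌊t⌋₊, ?_, Nat.floor_le ht.1, (Nat.lt_floor_add_one t).le⟩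
      exact Nat.lt_succ_iff.1 ((Nat.floor_lt ht.1).2 (by exact_mod_cast h))
    · exact ⟨2 * k, le_rfl, by push_cast; constructor <;> linarith⟩
  have h01 : t - n ∈ Icc (0 : ℝ) 1 := ⟨by linarith [htn.1], by linarith [htn.2]⟩
  rw [block, glue_of_mem_Icc (piece_one ρ n) htn]
  refine ⟨?_, norm_snd_piece_le hρ hn h01⟩
  rcases n with _ | n
  · simp only [piece, cyl_fst]
    constructor <;> linarith [h01.1, h01.2]
  · exact Icc_subset_Icc_left zero_le_one (fst_piece_succ_mem ρ n h01)

end Block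

section Eel

/-- The scale of the `m`-th block. -/
noncomputable def scale (m : ℕ) : ℝ := 1 / 16 / 2 ^ m

/-- The number of helices in the `m`-th block. -/
def turns (m : ℕ) : ℕ := 2 * 2 ^ m

/-- The first helix radius of the `m`-th block, before rescaling. -/
noncomputable def coreRadius (m : ℕ) : ℝ := 1 / 2000 / 20 ^ turns m

/-- The parameter at which the `m`-th block stops. -/
noncomputable def duration (m : ℕ) : ℝ := 2 * turns m + 1

/-- The starting point of the `m`-th rescaled block. -/
noncomputable def origin : ℕ → Cyl
  | 0 => 0
  | m + 1 => origin m + scale m • block (coreRadius m) (duration m)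

/-- The `m`-th rescaled block. -/
noncomputable def stage (m : ℕ) (s : ℝ) : Cyl :=
  origin m + scale m • block (coreRadius m) (duration m * s)

/-- The right derivative of `stage`. -/
noncomputable def stageDeriv (m : ℕ) (s : ℝ) : Cyl :=
  (scale m * duration m) • blockDeriv (coreRadius m) (duration m * s)

theorem scale_pos (m : ℕ) : 0 < scale m := by unfold scale; positivity

theorem scale_succ (m : ℕ) : scale (m + 1) = scale m / 2 := by
  unfold scale; rw [pow_succ]; field_simp

theorem scale_le (m : ℕ) : scale m ≤ 1 / 16 :=
  div_le_self (by norm_num) (one_le_pow₀ one_le_two)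

theorem tendsto_scale : Tendsto scale atTop (nhds 0) := by
  have := (tendsto_pow_atTop_nhds_zero_of_lt_one (r := (1 / 2 : ℝ)) (by norm_num)
    (by norm_num)).const_mul (1 / 16)
  rw [mul_zero] at this
  refine this.congr fun m => ?_
  rw [scale, one_div_pow, ← div_eq_mul_one_div]

theorem coreRadius_pos (m : ℕ) : 0 < coreRadius m := by unfold coreRadius; positivity

theorem duration_pos (m : ℕ) : 0 < duration m := by unfold duration; positivity

theorem radius_coreRadius_le (m : ℕ) : radius (coreRadius m) (turns m) ≤ 1 / 2000 := by
  have h := twenty_mul_radius_le (coreRadius_pos m) (turns m)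
  have h0 := radius_nonneg (coreRadius_pos m) (turns m)
  rw [radius, coreRadius, div_mul_cancel₀ _ (by positivity)] at h
  unfold coreRadius at *
  linarith

theorem block_stage_mem (m : ℕ) {s : ℝ} (hs : s ∈ Icc (0 : ℝ) 1) :
    (block (coreRadius m) (duration m * s)).fst ∈ Icc (0 : ℝ) 2 ∧
      ‖(block (coreRadius m) (duration m * s)).snd‖ ≤ 1 / 2000 := by
  have hd := duration_pos m
  have := block_mem (coreRadius_pos m) (turns m) (t := duration m * s)
    ⟨mul_nonneg hd.le hs.1, mul_le_of_le_one_right hd.le hs.2⟩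
  exact ⟨this.1, this.2.trans (radius_coreRadius_le m)⟩

theorem stage_zero (m : ℕ) : stage m 0 = origin m := by
  simp [stage, block_zero]

theorem stage_one (m : ℕ) : stage m 1 = origin (m + 1) := by
  simp [stage, origin]

theorem fst_block_duration (m : ℕ) : (block (coreRadius m) (duration m)).fst = 2 := by
  rw [duration, fst_block_odd, level, turns, pow_mul]
  norm_num

theorem stage_sub_origin_below {m n : ℕ} (hmn : m < n) {s : ℝ} (hs : s ∈ Icc (0 : ℝ) 1) :
    (stage m s - origin n).fst ≤ 0 ∧
      ‖(stage m s - origin n).snd‖ ≤ 1 / 500 * (scale n - (stage m s - origin n).fst) := by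
  induction n, hmn using Nat.le_induction with
  | base =>
    have h1 := block_stage_mem m hs
    have h2 := block_stage_mem m (right_mem_Icc.2 zero_le_one)
    have h3 := fst_block_duration m
    rw [mul_one] at h2
    have e : stage m s - origin (m + 1) = scale m •
        (block (coreRadius m) (duration m * s) - block (coreRadius m) (duration m)) := by
      rw [stage, origin]; module
    have h4 := norm_sub_le (block (coreRadius m) (duration m * s)).snd
      (block (coreRadius m) (duration m)).snd
    have hs := scale_pos m
    rw [e, WithLp.smul_fst, WithLp.smul_snd, WithLp.sub_fst, WithLp.sub_snd, norm_smul,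
      Real.norm_of_nonneg hs.le, scale_succ, h3, smul_eq_mul]
    constructor <;> nlinarith [h1.1.2]
  | succ n hmn ih =>
    have h2 := block_stage_mem n (right_mem_Icc.2 zero_le_one)
    rw [mul_one] at h2
    have h3 := fst_block_duration n
    have e : stage m s - origin (n + 1) = (stage m s - origin n) -
        scale n • block (coreRadius n) (duration n) := by
      rw [origin]; module
    have h4 := norm_sub_le (stage m s - origin n).snd
      (scale n • block (coreRadius n) (duration n)).snd
    have hs := scale_pos n
    rw [WithLp.smul_snd, norm_smul, Real.norm_of_nonneg hs.le] at h4
    rw [e, WithLp.sub_fst, WithLp.sub_snd, WithLp.smul_fst, WithLp.smul_snd, scale_succ, h3,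
      smul_eq_mul]
    constructor <;> nlinarith [ih.1, ih.2]

/-- An infinitely long curve in the cylinder model. -/
noncomputable def eel : ℝ → Cyl := glue stage

/-- The right derivative of `eel`. -/
noncomputable def eelDeriv : ℝ → Cyl := glue stageDeriv

theorem isConeCurve_eel : IsConeCurve eel eelDeriv := by
  refine isConeCurve_glue
    (fun m => (isConeCurve_block (coreRadius_pos m)).isConeArc _ (scale_pos m) (duration_pos m))
    (fun m => (stage_one m).trans (stage_zero _).symm) fun m n hmn s hs t ht => ?_
  have hn := scale_pos n
  have h := stage_sub_origin_below hmn (Ico_subset_Icc_self hs)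
  have e : stage m s - stage n t = scale n • ((scale n)⁻¹ • (stage m s - origin n) -
      block (coreRadius n) (duration n * t)) := by
    rw [smul_sub, smul_inv_smul₀ hn.ne', stage, stage]
    abel
  rw [e]
  refine ConeBound.smul (coneBound_block_of_below (coreRadius_pos n)
    (mul_nonneg (duration_pos n).le ht.1) ?_ ?_) (mul_pos hn (duration_pos n)).le hn.le
  · rw [WithLp.smul_fst]
    exact mul_nonpos_of_nonneg_of_nonpos (by positivity) h.1
  · rw [WithLp.smul_fst, WithLp.smul_snd, norm_smul, Real.norm_of_nonneg (by positivity),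
      inv_mul_le_iff₀ hn, smul_eq_mul]
    refine h.2.trans_eq ?_
    field_simp

theorem dist_stage_origin_le (m : ℕ) {s : ℝ} (hs : s ∈ Icc (0 : ℝ) 1) :
    dist (stage m s) (origin m) ≤ 3 * scale m := by
  have h := block_stage_mem m hs
  have hsq := WithLp.prod_norm_sq_eq_of_L2 (block (coreRadius m) (duration m * s))
  have h3 : ‖block (coreRadius m) (duration m * s)‖ ≤ 3 := by
    refine (le_abs_self _).trans (abs_le_of_sq_le_sq ?_ (by norm_num))
    rw [hsq, Real.norm_of_nonneg h.1.1]
    nlinarith [h.1.1, h.1.2, h.2,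
      norm_nonneg (block (coreRadius m) (duration m * s)).snd]
  rw [dist_eq_norm, stage, add_sub_cancel_left, norm_smul, Real.norm_of_nonneg (scale_pos m).le,
    mul_comm]
  exact mul_le_mul_of_nonneg_right h3 (scale_pos m).le

theorem eel_eq {t : ℝ} (ht : 0 ≤ t) : ∃ s ∈ Icc (0 : ℝ) 1, eel t = stage ⌊t⌋₊ s :=
  ⟨t - ⌊t⌋₊, ⟨by linarith [Nat.floor_le ht], by linarith [Nat.lt_floor_add_one t]⟩, rfl⟩

theorem exists_limit_eel : ∃ L : Cyl, ‖L‖ ≤ 6 / 16 ∧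
    ∀ t : ℝ, 0 ≤ t → dist (eel t) L ≤ 9 * scale ⌊t⌋₊ := by
  have step (m : ℕ) : dist (origin m) (origin (m + 1)) ≤ 3 / 8 / 2 / 2 ^ m := by
    rw [dist_comm, ← stage_one]
    refine (dist_stage_origin_le m (right_mem_Icc.2 zero_le_one)).trans_eq ?_
    rw [scale]; ring
  obtain ⟨L, hL⟩ := cauchySeq_tendsto_of_complete (cauchySeq_of_le_geometric_two step)
  have hd := dist_le_of_le_geometric_two_of_tendsto step hL
  refine ⟨L, ?_, fun t ht => ?_⟩
  · have := hd 0
    rw [origin, dist_zero_left] at this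
    norm_num at this ⊢
    exact this
  · obtain ⟨s, hs, h⟩ := eel_eq ht
    have h1 := dist_stage_origin_le ⌊t⌋₊ hs
    have h2 := hd ⌊t⌋₊
    have h3 := dist_triangle (stage ⌊t⌋₊ s) (origin ⌊t⌋₊) L
    have h4 : 3 / 8 / 2 ^ ⌊t⌋₊ = 6 * scale ⌊t⌋₊ := by rw [scale]; ring
    rw [h]
    linarith

theorem tendsto_eel : ∃ L : Cyl, Tendsto eel atTop (nhds L) := by
  obtain ⟨L, -, hL⟩ := exists_limit_eel
  refine ⟨L, tendsto_iff_dist_tendsto_zero.2 ?_⟩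
  have : Tendsto (fun t : ℝ => 9 * scale ⌊t⌋₊) atTop (nhds 0) := by
    simpa using (tendsto_scale.comp tendsto_nat_floor_atTop).const_mul 9
  refine squeeze_zero' (.of_forall fun _ => dist_nonneg) ?_ this
  filter_upwards [eventually_ge_atTop 0] with t ht using hL t ht

theorem norm_eel_le {t : ℝ} (ht : 0 ≤ t) : ‖eel t‖ ≤ 1 := by
  obtain ⟨L, h0, hL⟩ := exists_limit_eel
  have h1 := hL t ht
  have h2 := norm_le_norm_add_norm_sub' (eel t) L
  rw [dist_eq_norm] at h1
  linarith [scale_le ⌊t⌋₊]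

theorem abs_level_succ_sub (k : ℕ) : |level (k + 1) - level k| = 1 := by
  rw [level_succ, add_sub_cancel_left,
    ← pow_eq_one_iff_of_nonneg (abs_nonneg _) two_ne_zero, sq_abs, climb_sq]

theorem le_eVariationOn_eel (m : ℕ) :
    ENNReal.ofReal (1 / 8) ≤ eVariationOn eel (Icc (m : ℝ) (m + 1)) := by
  set u : ℕ → ℝ := fun i => m + (2 * i + 1) / duration m with hu
  have hd := duration_pos m
  have hmono : Monotone u := fun i j hij => by
    simp only [hu]; gcongr
  have hmem (i : ℕ) (hi : i ≤ turns m) : u i ∈ Icc (m : ℝ) (m + 1) := by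
    have : (2 * i + 1) / duration m ≤ 1 := by
      rw [div_le_one hd, duration]; gcongr
    have : 0 ≤ (2 * i + 1) / duration m := by positivity
    constructor <;> simp only [hu] <;> linarith
  have hval (i : ℕ) (hi : i ≤ turns m) :
      (eel (u i)).fst = (origin m).fst + scale m * level i := by
    rw [eel, glue_of_mem_Icc ((stage_one m).trans (stage_zero _).symm) (hmem i hi), stage,
      WithLp.add_fst, WithLp.smul_fst, hu]
    simp only [add_sub_cancel_left]
    rw [mul_div_cancel₀ _ hd.ne', fst_block_odd, smul_eq_mul]
  have hstep : ∀ i ∈ Finset.range (turns m),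
      ENNReal.ofReal (scale m) ≤ edist (eel (u (i + 1))) (eel (u i)) := fun i hi => by
    have hi := Finset.mem_range.1 hi
    rw [edist_dist, dist_eq_norm]
    refine ENNReal.ofReal_le_ofReal (le_trans (le_of_eq ?_) (WithLp.norm_fst_le _ _))
    rw [WithLp.sub_fst, hval _ hi, hval _ hi.le, add_sub_add_left_eq_sub, ← mul_sub, norm_mul,
      Real.norm_eq_abs (level _ - _), abs_level_succ_sub, mul_one,
      Real.norm_of_nonneg (scale_pos m).le]
  have h1 := Finset.card_nsmul_le_sum _ _ _ hstep
  rw [Finset.card_range, ← ENNReal.ofReal_nsmul] at h1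
  have h2 : turns m • scale m = 1 / 8 := by
    rw [nsmul_eq_mul, scale, turns]
    push_cast
    field_simp
    norm_num
  rw [h2] at h1
  exact h1.trans (eVariationOn.sum_le_of_monotoneOn_Iic (hmono.monotoneOn _) hmem)

theorem eVariationOn_eel : eVariationOn eel (Ici 0) = ⊤ := by
  by_contra h
  obtain ⟨n, hn⟩ := ENNReal.exists_nat_mul_gt
    (ENNReal.ofReal_pos.2 (by norm_num : (0 : ℝ) < 1 / 8)).ne' h
  refine hn.not_ge ?_
  have h1 := eVariationOn.sum' eel (I := fun i : ℕ => (i : ℝ)) Nat.mono_cast (n := n)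
  have h2 := Finset.card_nsmul_le_sum (Finset.range n) _ _ fun i _ => le_eVariationOn_eel i
  rw [Finset.card_range, nsmul_eq_mul] at h2
  push_cast at h1
  rw [h1] at h2
  exact h2.trans (eVariationOn.mono _ Icc_subset_Ici_self)

theorem finrank_cyl : Module.finrank ℝ Cyl = 3 := by
  rw [(WithLp.linearEquiv 2 ℝ (ℝ × ℂ)).finrank_eq]
  simp

end Eel

/-- **a λ-eel of infinite length.** For `λ = 1/√5` there is a continuous
curve `γ : [0,∞) → ℝ³` contained in the closed unit ball, with nonzero right derivative
at every point, satisfying the `λ`-cone property, with infinite length, and such that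
`lim_{t→∞} γ(t)` exists. -/
theorem exists_lambda_eel_infinite_length :
    ∃ γ γ' : ℝ → EuclideanSpace ℝ (Fin 3),
      ContinuousOn γ (Set.Ici 0) ∧
      (∀ τ : ℝ, 0 ≤ τ → HasDerivWithinAt γ (γ' τ) (Set.Ici τ) τ ∧ γ' τ ≠ 0) ∧
      (∀ t : ℝ, 0 ≤ t → ‖γ t‖ ≤ 1) ∧
      (∀ t τ : ℝ, 0 ≤ t → t < τ →
        ⟪γ' τ, γ t - γ τ⟫ ≤ (1 / Real.sqrt 5) * ‖γ' τ‖ * ‖γ t - γ τ‖) ∧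
      eVariationOn γ (Set.Ici 0) = ⊤ ∧
      ∃ L : EuclideanSpace ℝ (Fin 3), Tendsto γ atTop (nhds L) := by
  let φ : Cyl ≃ₗᵢ[ℝ] EuclideanSpace ℝ (Fin 3) :=
    ((stdOrthonormalBasis ℝ Cyl).reindex (finCongr finrank_cyl)).repr
  obtain ⟨L, hL⟩ := tendsto_eel
  refine ⟨fun t => φ (eel t), fun t => φ (eelDeriv t),
    φ.continuous.comp_continuousOn isConeCurve_eel.continuousOn,
    fun τ hτ => ⟨?_, ?_⟩, fun t ht => ?_, fun t τ ht hτ => ?_, ?_,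
    φ L, (φ.continuous.tendsto L).comp hL⟩
  · exact φ.toContinuousLinearEquiv.toContinuousLinearMap.hasFDerivAt.comp_hasDerivWithinAt τ
      (isConeCurve_eel.hasDeriv τ hτ)
  · simpa using isConeCurve_eel.ne_zero τ hτ
  · rw [φ.norm_map]
    exact norm_eel_le ht
  · rw [← map_sub, φ.inner_map_map, φ.norm_map, φ.norm_map]
    exact isConeCurve_eel.cone t τ ht hτ
  · rw [← eVariationOn_eel]
    simp only [eVariationOn, φ.isometry.edist_eq]
end

section
/- Let λ ∈ [−1,1) and let γ : I → ℝ² be an injective λ-eel. Then for all t₁ < t₂ < t₃ in I, the point γ(t₃) does not belong to the closed segment [γ(t₁), γ(t₂)] = {(1−s)γ(t₁) + sγ(t₂) : s ∈ [0,1]}. -/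
open scoped RealInnerProductSpace
open Set

/-- An injective `λ`-eel parametrized by `[A, T]`, with the right derivative prescribed on
`[A, T)` only. -/
structure IsInjEelOn {E : Type*} [NormedAddCommGroup E] [InnerProductSpace ℝ E]
    (lam : ℝ) (w w' : ℝ → E) (A T : ℝ) : Prop where
  cont : ContinuousOn w (Icc A T)
  deriv : ∀ τ ∈ Ico A T, HasDerivWithinAt w (w' τ) (Ici τ) τ
  ne : ∀ τ ∈ Ico A T, w' τ ≠ 0
  eel : ∀ t τ, A ≤ t → t < τ → τ < T → ⟪w' τ, w t - w τ⟫ ≤ lam * ‖w' τ‖ * ‖w t - w τ‖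
  inj : InjOn w (Icc A T)

theorem IsInjEelOn.map_sub {E F : Type*} [NormedAddCommGroup E] [InnerProductSpace ℝ E]
    [NormedAddCommGroup F] [InnerProductSpace ℝ F] {lam : ℝ} {w w' : ℝ → E} {A T : ℝ}
    (h : IsInjEelOn lam w w' A T) (e : E ≃ₗᵢ[ℝ] F) (x : E) :
    IsInjEelOn lam (fun t => e (w t - x)) (fun t => e (w' t)) A T where
  cont := e.continuous.comp_continuousOn (h.cont.sub continuousOn_const)
  deriv τ hτ := e.toContinuousLinearEquiv.toContinuousLinearMap.hasFDerivAt.comp_hasDerivWithinAt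
    τ ((h.deriv τ hτ).sub_const x)
  ne τ hτ := by simpa using h.ne τ hτ
  eel t τ h1 h2 h3 := by
    rw [← _root_.map_sub, sub_sub_sub_cancel_right, e.inner_map_map, e.norm_map, e.norm_map]
    exact h.eel t τ h1 h2 h3
  inj s hs t ht hst := h.inj hs ht (by simpa using hst)

theorem IsInjEelOn.map {E F : Type*} [NormedAddCommGroup E] [InnerProductSpace ℝ E]
    [NormedAddCommGroup F] [InnerProductSpace ℝ F] {lam : ℝ} {w w' : ℝ → E} {A T : ℝ}
    (h : IsInjEelOn lam w w' A T) (e : E ≃ₗᵢ[ℝ] F) :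
    IsInjEelOn lam (fun t => e (w t)) (fun t => e (w' t)) A T := by
  simpa using h.map_sub e 0

theorem IsInjEelOn.not_mem_ray {E : Type*} [NormedAddCommGroup E] [InnerProductSpace ℝ E]
    {lam : ℝ} {w w' : ℝ → E} {A T : ℝ} (h : IsInjEelOn lam w w' A T) (hlam : lam < 1)
    {t τ r : ℝ} (hA : A ≤ t) (ht : t < τ) (hT : τ < T) (hr : 0 < r) :
    w t - w τ ≠ r • w' τ := by
  intro hw
  have h1 := h.eel t τ hA ht hT
  have h2 : 0 < ‖w' τ‖ := norm_pos_iff.2 (h.ne τ ⟨by linarith, hT⟩)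
  rw [hw, inner_smul_right, norm_smul, real_inner_self_eq_norm_sq, Real.norm_of_nonneg hr.le] at h1
  have h3 : 0 < r * ‖w' τ‖ ^ 2 := by positivity
  nlinarith

/-- Two disjoint arcs have a continuous angle of their difference. -/
theorem exists_continuous_arg_sub {f g : ℝ → ℂ} {a b c d : ℝ} (hab : a ≤ b) (hcd : c ≤ d)
    (hf : ContinuousOn f (Icc a b)) (hg : ContinuousOn g (Icc c d))
    (hne : ∀ s ∈ Icc a b, ∀ t ∈ Icc c d, f s ≠ g t) :
    ∃ θ : ℝ × ℝ → ℝ, Continuous θ ∧ ∀ s ∈ Icc a b, ∀ t ∈ Icc c d, ∃ r > 0,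
      (f s - g t).re = r * Real.cos (θ (s, t)) ∧ (f s - g t).im = r * Real.sin (θ (s, t)) := by
  have hf' : Continuous (IccExtend hab ((Icc a b).domRestrict f)) :=
    (continuousOn_iff_continuous_domRestrict.1 hf).Icc_extend'
  have hg' : Continuous (IccExtend hcd ((Icc c d).domRestrict g)) :=
    (continuousOn_iff_continuous_domRestrict.1 hg).Icc_extend'
  let F : C(ℝ × ℝ, ℂ) :=
    ⟨fun p => IccExtend hab ((Icc a b).domRestrict f) p.1 - IccExtend hcd ((Icc c d).domRestrict g) p.2,
      by fun_prop⟩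
  have hF : ∀ p, F p ≠ 0 := fun p =>
    sub_ne_zero.2 (hne _ (projIcc a b hab p.1).2 _ (projIcc c d hcd p.2).2)
  obtain ⟨G, ⟨-, hG⟩, -⟩ := Complex.isCoveringMapOn_exp.existsUnique_continuousMap_lifts F
    (a₀ := 0) (e₀ := Complex.log (F 0)) (Complex.exp_log (hF 0)) hF
  refine ⟨fun p => (G p).im, by fun_prop, fun s hs t ht => ⟨Real.exp (G (s, t)).re,
    Real.exp_pos _, ?_⟩⟩
  have h1 : f s - g t = Complex.exp (G (s, t)) := by
    have := congrFun hG (s, t)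
    simp only [Function.comp_apply] at this
    rw [this]
    simp [F, IccExtend_of_mem _ _ hs, IccExtend_of_mem _ _ ht]
  rw [h1, Complex.exp_re, Complex.exp_im]
  exact ⟨rfl, rfl⟩

theorem lt_of_continuousOn_of_ne {θ : ℝ → ℝ} {p q x : ℝ} (hpq : p ≤ q)
    (hθ : ContinuousOn θ (Icc p q)) (hne : ∀ s ∈ Icc p q, θ s ≠ x) (hp : θ p < x) : θ q < x := by
  by_contra! h
  obtain ⟨s, hs, hs'⟩ := intermediate_value_Icc hpq hθ ⟨hp.le, h⟩
  exact hne s hs hs'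

theorem gt_of_continuousOn_of_ne {θ : ℝ → ℝ} {p q x : ℝ} (hpq : p ≤ q)
    (hθ : ContinuousOn θ (Icc p q)) (hne : ∀ s ∈ Icc p q, θ s ≠ x) (hp : x < θ p) : x < θ q := by
  by_contra! h
  obtain ⟨s, hs, hsx⟩ := intermediate_value_Icc' hpq hθ ⟨h, hp.le⟩
  exact hne s hs hsx

/-- An angle starting in `[π, 2π]` whose sine is never positive stays in `[π, 2π]`. -/
theorem mem_Icc_pi_of_sin_nonpos {θ : ℝ → ℝ} {p q : ℝ} (hpq : p ≤ q)
    (hθ : ContinuousOn θ (Icc p q)) (hsin : ∀ s ∈ Icc p q, Real.sin (θ s) ≤ 0)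
    (hp : θ p ∈ Icc Real.pi (2 * Real.pi)) : θ q ∈ Icc Real.pi (2 * Real.pi) := by
  have hpi := Real.pi_pos
  constructor
  · by_contra! h
    have h0 : 0 < max (θ q) (Real.pi / 2) := lt_max_of_lt_right (by positivity)
    have h1 : max (θ q) (Real.pi / 2) < Real.pi := max_lt h (by linarith)
    obtain ⟨s, hs, hs'⟩ := intermediate_value_Icc' hpq hθ
      ⟨le_max_left (θ q) (Real.pi / 2), h1.le.trans hp.1⟩
    have := hsin s hs
    rw [hs'] at this
    exact absurd (Real.sin_pos_of_pos_of_lt_pi h0 h1) this.not_gt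
  · by_contra! h
    have h0 : 2 * Real.pi < min (θ q) (2 * Real.pi + Real.pi / 2) := lt_min h (by linarith)
    have h1 : min (θ q) (2 * Real.pi + Real.pi / 2) < 2 * Real.pi + Real.pi :=
      min_lt_of_right_lt (by linarith)
    obtain ⟨s, hs, hs'⟩ := intermediate_value_Icc hpq hθ
      ⟨hp.2.trans h0.le, min_le_left (θ q) (2 * Real.pi + Real.pi / 2)⟩
    have := hsin s hs
    rw [hs', ← Real.sin_sub_two_pi] at this
    exact absurd (Real.sin_pos_of_pos_of_lt_pi (by linarith) (by linarith)) this.not_gt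

/-- An arc `f` in the closed upper half plane joining two real points on both sides of `g d` cannot
be disjoint from an arc `g` in the upper half plane ending at the real point `g d`, if the
starting point of `g` is joined to infinity by a ray in the upper half plane that misses `f`. -/
theorem not_disjoint_arc_and_ray {f g : ℝ → ℂ} {a b c d : ℝ} {v : ℂ} (hab : a ≤ b) (hcd : c < d)
    (hf : ContinuousOn f (Icc a b)) (hg : ContinuousOn g (Icc c d))
    (hne : ∀ s ∈ Icc a b, ∀ t ∈ Icc c d, f s ≠ g t)
    (hfim : ∀ s ∈ Icc a b, 0 ≤ (f s).im) (hfa : (f a).im = 0) (hfb : (f b).im = 0)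
    (hgim : ∀ t ∈ Ico c d, 0 < (g t).im) (hgd : g d = 0)
    (hfa' : (f a).re < 0) (hfb' : 0 < (f b).re)
    (hv0 : v ≠ 0) (hv : 0 ≤ v.im) (hray : ∀ s ∈ Icc a b, ∀ r : ℝ, 0 < r → f s - g c ≠ r • v) :
    False := by
  have hpi := Real.pi_pos
  obtain ⟨θ₀, hθ₀, hθ₀'⟩ := exists_continuous_arg_sub hab hcd.le hf hg hne
  have haa : a ∈ Icc a b := left_mem_Icc.2 hab
  have hbb : b ∈ Icc a b := right_mem_Icc.2 hab
  have hcc : c ∈ Icc c d := left_mem_Icc.2 hcd.le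
  have hdd : d ∈ Icc c d := right_mem_Icc.2 hcd.le
  obtain ⟨θ, hθ, hθ', hc1⟩ : ∃ θ : ℝ × ℝ → ℝ, Continuous θ ∧ (∀ s ∈ Icc a b, ∀ t ∈ Icc c d,
      ∃ r > 0, (f s - g t).re = r * Real.cos (θ (s, t)) ∧
        (f s - g t).im = r * Real.sin (θ (s, t))) ∧
      θ (a, c) ∈ Ico 0 (2 * Real.pi) := by
    refine ⟨fun p => θ₀ p - toIcoDiv Real.two_pi_pos 0 (θ₀ (a, c)) * (2 * Real.pi),
      by fun_prop, fun s hs t ht => ?_, ?_⟩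
    · simpa only [Real.cos_sub_int_mul_two_pi, Real.sin_sub_int_mul_two_pi] using hθ₀' s hs t ht
    · have := sub_toIcoDiv_zsmul_mem_Ico Real.two_pi_pos 0 (θ₀ (a, c))
      simpa using this
  have sin_neg : ∀ s ∈ Icc a b, ∀ t ∈ Icc c d, (f s - g t).im < 0 → Real.sin (θ (s, t)) < 0 := by
    intro s hs t ht h
    obtain ⟨r, hr, -, h2⟩ := hθ' s hs t ht
    rw [h2] at h
    by_contra! h3
    exact absurd (mul_nonneg hr.le h3) h.not_ge
  have sin_nonpos : ∀ s ∈ Icc a b, (f s).im = 0 → ∀ t ∈ Icc c d, Real.sin (θ (s, t)) ≤ 0 := by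
    intro s hs h t ht
    obtain ⟨r, hr, -, h2⟩ := hθ' s hs t ht
    have : 0 ≤ (g t).im := by
      rcases ht.2.eq_or_lt with rfl | h
      · simp [hgd]
      · exact (hgim t ⟨ht.1, h⟩).le
    rw [Complex.sub_im, h] at h2
    by_contra! h3
    nlinarith [mul_pos hr h3]
  have hgc := hgim c ⟨le_rfl, hcd⟩
  have sac := sin_neg a haa c hcc (by simp [hfa, hgc])
  have sbc := sin_neg b hbb c hcc (by simp [hfb, hgc])
  have hac : Real.pi < θ (a, c) := by
    by_contra! h
    exact absurd (Real.sin_nonneg_of_nonneg_of_le_pi hc1.1 h) sac.not_ge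
  -- the angle along `f` seen from `g c` avoids the angle of `v`
  have hφ0 : 0 ≤ v.arg := Complex.arg_nonneg_iff.2 hv
  have hφπ : v.arg ≤ Real.pi := Complex.arg_le_pi v
  have hnv : 0 < ‖v‖ := norm_pos_iff.2 hv0
  have avoid : ∀ s ∈ Icc a b, ∀ x, Real.cos x = Real.cos v.arg → Real.sin x = Real.sin v.arg →
      θ (s, c) ≠ x := by
    intro s hs x hx1 hx2 hx
    obtain ⟨r, hr, h1, h2⟩ := hθ' s hs c hcc
    rw [hx, hx1, Complex.cos_arg hv0] at h1
    rw [hx, hx2, Complex.sin_arg] at h2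
    refine hray s hs (r / ‖v‖) (by positivity) (Complex.ext ?_ ?_)
    · rw [h1, Complex.real_smul, Complex.re_ofReal_mul]; ring
    · rw [h2, Complex.real_smul, Complex.im_ofReal_mul]; ring
  have hcontc : ContinuousOn (fun s => θ (s, c)) (Icc a b) := by fun_prop
  have hbc1 : v.arg < θ (b, c) := gt_of_continuousOn_of_ne (θ := fun s => θ (s, c)) hab hcontc
    (fun s hs => avoid s hs _ rfl rfl) (by linarith)
  have hbc2 : θ (b, c) < v.arg + 2 * Real.pi :=
    lt_of_continuousOn_of_ne (θ := fun s => θ (s, c)) hab hcontc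
    (fun s hs => avoid s hs _ (Real.cos_add_two_pi _) (Real.sin_add_two_pi _))
      (by linarith [hc1.2])
  have hbc : θ (b, c) ∈ Icc Real.pi (2 * Real.pi) := by
    constructor
    · by_contra! h
      exact absurd (Real.sin_nonneg_of_nonneg_of_le_pi (by linarith) h.le) sbc.not_ge
    · by_contra! h
      rw [← Real.sin_sub_two_pi] at sbc
      exact absurd (Real.sin_nonneg_of_nonneg_of_le_pi (by linarith) (by linarith)) sbc.not_ge
  have had := mem_Icc_pi_of_sin_nonpos (θ := fun t => θ (a, t)) hcd.le (by fun_prop)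
    (sin_nonpos a haa hfa) ⟨hac.le, hc1.2.le⟩
  have hbd := mem_Icc_pi_of_sin_nonpos (θ := fun t => θ (b, t)) hcd.le (by fun_prop)
    (sin_nonpos b hbb hfb) hbc
  have had' : θ (a, d) ≤ 3 * Real.pi / 2 := by
    by_contra! h
    obtain ⟨r, hr, h1, -⟩ := hθ' a haa d hdd
    rw [hgd, sub_zero, ← Real.cos_sub_two_pi] at h1
    have : 0 ≤ Real.cos (θ (a, d) - 2 * Real.pi) :=
      Real.cos_nonneg_of_mem_Icc ⟨by linarith, by linarith [had.2]⟩
    nlinarith [mul_nonneg hr.le this]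
  have hbd' : 3 * Real.pi / 2 ≤ θ (b, d) := by
    by_contra! h
    obtain ⟨r, hr, h1, -⟩ := hθ' b hbb d hdd
    rw [hgd, sub_zero] at h1
    have : Real.cos (θ (b, d)) ≤ 0 :=
      Real.cos_nonpos_of_pi_div_two_le_of_le (by linarith [hbd.1]) (by linarith)
    nlinarith [mul_nonneg hr.le (neg_nonneg.2 this)]
  obtain ⟨s, hs, hs'⟩ := intermediate_value_Icc (f := fun s => θ (s, d)) hab (by fun_prop)
    ⟨had', hbd'⟩
  obtain ⟨r, hr, -, h2⟩ := hθ' s hs d hdd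
  simp only at hs'
  have : Real.sin (3 * Real.pi / 2) = -1 := by
    rw [← Real.sin_sub_two_pi, show 3 * Real.pi / 2 - 2 * Real.pi = -(Real.pi / 2) by ring,
      Real.sin_neg, Real.sin_pi_div_two]
  rw [hgd, sub_zero, hs', this] at h2
  linarith [hfim s hs]

theorem exists_last_zero {f : ℝ → ℝ} {p q : ℝ} (hpq : p ≤ q) (hf : ContinuousOn f (Icc p q))
    (hp : f p ≤ 0) (hq : 0 < f q) : ∃ c ∈ Ico p q, f c = 0 ∧ ∀ t ∈ Ioc c q, 0 < f t := by
  have hK : IsCompact (Icc p q ∩ f ⁻¹' {0}) :=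
    isCompact_Icc.of_isClosed_subset (hf.preimage_isClosed_of_isClosed isClosed_Icc
      isClosed_singleton) inter_subset_left
  obtain ⟨s, hs, hs'⟩ := intermediate_value_Icc hpq hf ⟨hp, hq.le⟩
  obtain ⟨c, ⟨hc, hc0⟩, hmax⟩ := hK.exists_isGreatest ⟨s, hs, hs'⟩
  simp only [mem_preimage, mem_singleton_iff] at hc0
  refine ⟨c, ⟨hc.1, hc.2.lt_of_ne ?_⟩, hc0, fun t ht => ?_⟩
  · rintro rfl
    exact hq.ne' hc0
  · by_contra! h
    obtain ⟨u, hu, hu'⟩ := intermediate_value_Icc ht.2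
      (hf.mono (Icc_subset_Icc_left (hc.1.trans ht.1.le))) ⟨h, hq.le⟩
    have := hmax ⟨⟨hc.1.trans (ht.1.le.trans hu.1), hu.2⟩, hu'⟩
    linarith [ht.1, hu.1]

/-- The sign of a nowhere vanishing continuous function on an open interval is constant. -/
theorem pos_or_neg_of_ne_zero {f : ℝ → ℝ} {a b : ℝ} (hf : ContinuousOn f (Ioo a b))
    (hne : ∀ t ∈ Ioo a b, f t ≠ 0) : (∀ t ∈ Ioo a b, 0 < f t) ∨ ∀ t ∈ Ioo a b, f t < 0 := by
  by_contra! h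
  obtain ⟨⟨s, hs, hs'⟩, t, ht, ht'⟩ := h
  obtain ⟨u, hu, hu0⟩ := isPreconnected_Ioo.intermediate_value hs ht hf ⟨hs', ht'⟩
  exact hne u hu hu0

/-- Between a zero where `g` is negative and a zero where `g` is positive there are two consecutive
zeros of `f` where `g` has opposite signs. -/
theorem exists_consecutive_zeros {f g : ℝ → ℝ} {p q : ℝ} (hpq : p ≤ q)
    (hf : ContinuousOn f (Icc p q)) (hg : ContinuousOn g (Icc p q)) (hfp : f p = 0) (hfq : f q = 0)
    (hgp : g p < 0) (hgq : 0 < g q) (hne : ∀ t ∈ Icc p q, f t = 0 → g t ≠ 0) :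
    ∃ a b, p ≤ a ∧ a < b ∧ b ≤ q ∧ f a = 0 ∧ f b = 0 ∧ g a < 0 ∧ 0 < g b ∧
      ∀ t ∈ Ioo a b, f t ≠ 0 := by
  have closed {x y : ℝ} (hx : p ≤ x) (hy : y ≤ q) {h : ℝ → ℝ} (hh : ContinuousOn h (Icc p q))
      {s : Set ℝ} (hs : IsClosed s) : IsClosed (Icc x y ∩ h ⁻¹' s) :=
    (hh.mono (Icc_subset_Icc hx hy)).preimage_isClosed_of_isClosed isClosed_Icc hs
  have hK : IsCompact ((Icc p q ∩ f ⁻¹' {0}) ∩ (Icc p q ∩ g ⁻¹' Iic 0)) :=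
    isCompact_Icc.of_isClosed_subset ((closed le_rfl le_rfl hf isClosed_singleton).inter
      (closed le_rfl le_rfl hg isClosed_Iic)) (inter_subset_left.trans inter_subset_left)
  obtain ⟨a, ⟨⟨ha, hfa⟩, -, hga⟩, hamax⟩ := hK.exists_isGreatest
    ⟨p, ⟨left_mem_Icc.2 hpq, hfp⟩, left_mem_Icc.2 hpq, hgp.le⟩
  simp only [mem_preimage, mem_singleton_iff, mem_Iic] at hfa hga
  have hL : IsCompact ((Icc a q ∩ f ⁻¹' {0}) ∩ (Icc a q ∩ g ⁻¹' Ici 0)) :=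
    isCompact_Icc.of_isClosed_subset ((closed ha.1 le_rfl hf isClosed_singleton).inter
      (closed ha.1 le_rfl hg isClosed_Ici)) (inter_subset_left.trans inter_subset_left)
  obtain ⟨b, ⟨⟨hb, hfb⟩, -, hgb⟩, hbmin⟩ := hL.exists_isLeast
    ⟨q, ⟨right_mem_Icc.2 ha.2, hfq⟩, right_mem_Icc.2 ha.2, hgq.le⟩
  simp only [mem_preimage, mem_singleton_iff, mem_Ici] at hfb hgb
  have hga' := hga.lt_of_ne (hne a ha hfa)
  have hgb' := hgb.lt_of_ne' (hne b ⟨ha.1.trans hb.1, hb.2⟩ hfb)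
  refine ⟨a, b, ha.1, hb.1.lt_of_ne ?_, hb.2, hfa, hfb, hga', hgb', fun t ht hft => ?_⟩
  · rintro rfl
    linarith
  · have h1 : t ∈ Icc p q := ⟨ha.1.trans ht.1.le, ht.2.le.trans hb.2⟩
    have h2 : t ∈ Icc a q := ⟨ht.1.le, h1.2⟩
    rcases le_total (g t) 0 with h | h
    · exact absurd (hamax ⟨⟨h1, hft⟩, h1, h⟩) ht.1.not_ge
    · exact absurd (hbmin ⟨⟨h2, hft⟩, h2, h⟩) ht.2.not_ge

/-- If `(U, v)` and `(P, F)` lie in the closed first quadrant, the angle between them is not too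
small, and `(P, F)` is almost horizontal, then `(U, v)` is steeper than `(P, F)`. -/
theorem mul_lt_mul_of_inner_le {lam U v P F : ℝ} (hU : 0 ≤ U) (hv : 0 ≤ v) (hP : 0 < P)
    (hF : 0 ≤ F) (hUv : 0 < √(U ^ 2 + v ^ 2)) (hlam : lam * √(P ^ 2 + F ^ 2) < P)
    (h : U * P + v * F ≤ lam * √(U ^ 2 + v ^ 2) * √(P ^ 2 + F ^ 2)) : U * F < v * P := by
  by_contra! hc
  have hN := Real.sq_sqrt (show 0 ≤ U ^ 2 + v ^ 2 by positivity)
  set N := √(U ^ 2 + v ^ 2)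
  have h1 : U * P + v * F < N * P := by nlinarith [mul_lt_mul_of_pos_left hlam hUv]
  have h2 : 0 ≤ U * P + v * F := by positivity
  have h3 : (U * P + v * F) ^ 2 < (N * P) ^ 2 := by gcongr
  have h4 : (U * F - v * P) ^ 2 ≤ (U * F) ^ 2 := by
    have : 0 ≤ v * P := by positivity
    gcongr
    linarith
  nlinarith [mul_nonneg (sq_nonneg v) (sq_nonneg F)]

theorem Complex.norm_eq_sqrt_re_im (z : ℂ) : ‖z‖ = √(z.re ^ 2 + z.im ^ 2) := by
  rw [Complex.norm_def, Complex.normSq_apply, ← sq, ← sq]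

theorem IsInjEelOn.deriv_im {lam : ℝ} {w w' : ℝ → ℂ} {A T : ℝ} (h : IsInjEelOn lam w w' A T)
    {τ : ℝ} (hτ : τ ∈ Ico A T) :
    HasDerivWithinAt (fun t => (w t).im) (w' τ).im (Ici τ) τ :=
  Complex.imCLM.hasFDerivAt.comp_hasDerivWithinAt τ (h.deriv τ hτ)

theorem IsInjEelOn.cont_im {lam : ℝ} {w w' : ℝ → ℂ} {A T : ℝ} (h : IsInjEelOn lam w w' A T) :
    ContinuousOn (fun t => (w t).im) (Icc A T) :=
  Complex.continuous_im.comp_continuousOn h.cont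

/-- The right derivative of an eel cannot point upwards, from below the real line, into the
interval between the endpoints of a past arc in the upper half plane. -/
theorem IsInjEelOn.not_cross_arc {lam : ℝ} {w w' : ℝ → ℂ} {A T a b τ : ℝ}
    (h : IsInjEelOn lam w w' A T) (hlam : lam < 1) (hA : A ≤ a) (hab : a < b) (hb : b < τ)
    (hT : τ < T) (him : ∀ t ∈ Ioo a b, 0 < (w t).im) (hτ : (w τ).im ≤ 0) (hτ' : 0 ≤ (w' τ).im)
    (hca : 0 < (w' τ).re * (w a - w τ).im - (w' τ).im * (w a - w τ).re)
    (hcb : (w' τ).re * (w b - w τ).im - (w' τ).im * (w b - w τ).re < 0) : False := by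
  have hw : ContinuousOn w (Icc a b) := h.cont.mono (Icc_subset_Icc hA (by linarith))
  have hc : ContinuousOn (fun t => (w' τ).re * (w t - w τ).im - (w' τ).im * (w t - w τ).re)
      (Icc a b) := by
    have h1 := Complex.continuous_im.comp_continuousOn (hw.sub (continuousOn_const (c := w τ)))
    have h2 := Complex.continuous_re.comp_continuousOn (hw.sub (continuousOn_const (c := w τ)))
    exact (continuousOn_const.mul h1).sub (continuousOn_const.mul h2)
  obtain ⟨s, hs, hs'⟩ := intermediate_value_Ioo' hab.le hc ⟨hcb, hca⟩
  simp only at hs'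
  have hN : 0 < (w' τ).re ^ 2 + (w' τ).im ^ 2 := by
    have := Complex.normSq_pos.2 (h.ne τ ⟨by linarith, hT⟩)
    rwa [Complex.normSq_apply, ← sq, ← sq] at this
  set z := w' τ
  set d := w s - w τ with hd
  have hdz : d = ((z.re * d.re + z.im * d.im) / (z.re ^ 2 + z.im ^ 2)) • z := by
    apply Complex.ext
    · rw [Complex.real_smul, Complex.re_ofReal_mul]
      field_simp
      linear_combination (-z.im) * hs'
    · rw [Complex.real_smul, Complex.im_ofReal_mul]
      field_simp
      linear_combination z.re * hs'
  refine h.not_mem_ray hlam (hA.trans hs.1.le) (hs.2.trans hb) hT ?_ hdz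
  by_contra! hr
  have h1 : d.im = _ := congrArg Complex.im hdz
  rw [Complex.real_smul, Complex.im_ofReal_mul] at h1
  have h2 : 0 < d.im := by
    rw [hd, Complex.sub_im]
    linarith [him s hs]
  have h3 := mul_nonneg (neg_nonneg.2 hr) hτ'
  linarith

/-- Shortly before hitting the real line between the endpoints of a past arc in the upper half
plane, the curve goes down whenever it is not above the real line. -/
theorem IsInjEelOn.eventually_im_neg {lam : ℝ} {w w' : ℝ → ℂ} {A T a b : ℝ}
    (h : IsInjEelOn lam w w' A T) (hlam : lam < 1) (hA : A ≤ a) (hab : a < b) (hb : b < T)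
    (him : ∀ t ∈ Ioo a b, 0 < (w t).im) (ha : (w a).im = 0) (hb0 : (w b).im = 0)
    (ha' : (w a).re < 0) (hb' : 0 < (w b).re) (hT : w T = 0) :
    ∃ x ∈ Ico b T, ∀ τ ∈ Ioo x T, (w τ).im ≤ 0 → (w' τ).im < 0 := by
  have hw : Filter.Tendsto w (nhdsWithin T (Iio T)) (nhds 0) := by
    have := (h.cont T (right_mem_Icc.2 (by linarith))).mono_of_mem_nhdsWithin
      (Icc_mem_nhdsLT (by linarith))
    rw [ContinuousWithinAt, hT] at this
    exact this
  have key : ∀ c, 0 < c → ∀ᶠ z : ℂ in nhds 0, ∀ σ : ℝ, σ = 1 ∨ σ = -1 →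
      lam * √((c + σ * z.re) ^ 2 + z.im ^ 2) < c + σ * z.re ∧ 0 < c + σ * z.re := by
    intro c hc
    have (σ : ℝ) : ∀ᶠ z : ℂ in nhds 0,
        lam * √((c + σ * z.re) ^ 2 + z.im ^ 2) < c + σ * z.re ∧ 0 < c + σ * z.re := by
      have c1 : Continuous fun z : ℂ => lam * √((c + σ * z.re) ^ 2 + z.im ^ 2) := by fun_prop
      have c2 : Continuous fun z : ℂ => c + σ * z.re := by fun_prop
      refine (c1.continuousAt.eventually_lt c2.continuousAt ?_).and
        (continuousAt_const.eventually_lt c2.continuousAt ?_)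
      · simp only [Complex.zero_re, Complex.zero_im]
        rw [mul_zero, add_zero, zero_pow two_ne_zero, add_zero, Real.sqrt_sq hc.le]
        nlinarith
      · simpa using hc
    filter_upwards [this 1, this (-1)] with z h1 h2 σ hσ
    rcases hσ with rfl | rfl
    exacts [h1, h2]
  have hev := (hw.eventually (key _ (neg_pos.2 ha'))).and (hw.eventually (key _ hb'))
  obtain ⟨x, hx, hx'⟩ := (mem_nhdsLT_iff_exists_Ioo_subset' hb).1 hev
  refine ⟨max b x, ⟨le_max_left _ _, max_lt hb hx⟩, fun τ hτ hτ0 => ?_⟩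
  have hbτ : b < τ := (le_max_left _ _).trans_lt hτ.1
  obtain ⟨hka, hkb⟩ := hx' ⟨(le_max_right _ _).trans_lt hτ.1, hτ.2⟩
  obtain ⟨ka, pa⟩ := hka 1 (Or.inl rfl)
  obtain ⟨kb, pb⟩ := hkb (-1) (Or.inr rfl)
  by_contra! hv
  have ea := h.eel a τ hA (hab.trans hbτ) hτ.2
  have eb := h.eel b τ (hA.trans hab.le) hbτ hτ.2
  have hn := norm_pos_iff.2 (h.ne τ ⟨by linarith, hτ.2⟩)
  rw [Complex.inner, Complex.norm_eq_sqrt_re_im, Complex.norm_eq_sqrt_re_im] at ea eb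
  rw [Complex.norm_eq_sqrt_re_im] at hn
  have nca := h.not_cross_arc hlam hA hab hbτ hτ.2 him hτ0 hv
  simp only [Complex.mul_re, Complex.conj_re, Complex.conj_im, Complex.sub_re, Complex.sub_im,
    ha, hb0] at ea eb nca
  generalize (w' τ).re = u at *
  generalize (w' τ).im = v at *
  generalize (w a).re = p at *
  generalize (w b).re = q at *
  generalize (w τ).re = y at *
  generalize (w τ).im = f at *
  have sa : 0 ≤ -u → -u * -f < v * (-p + 1 * y) := by
    intro hu
    refine mul_lt_mul_of_inner_le (lam := lam) hu hv pa (neg_nonneg.2 hτ0) ?_ ?_ ?_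
    · rwa [neg_sq]
    · rwa [neg_sq]
    · convert ea using 1
      · ring
      · rw [neg_sq]
        congr 3 <;> ring
  have sb : 0 ≤ u → u * -f < v * (q + -1 * y) := by
    intro hu
    refine mul_lt_mul_of_inner_le (lam := lam) hu hv pb (neg_nonneg.2 hτ0) hn ?_ ?_
    · rwa [neg_sq]
    · convert eb using 1
      · ring
      · congr 3 <;> ring
  rcases le_total u 0 with hu | hu
  · have h1 := sa (neg_nonneg.2 hu)
    have h2 : 0 ≤ -u * -f := mul_nonneg (neg_nonneg.2 hu) (neg_nonneg.2 hτ0)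
    have h3 : 0 < v := by
      by_contra! h3
      nlinarith [mul_nonneg (neg_nonneg.2 h3) pa.le]
    exact nca (by linarith) (by linarith [mul_pos h3 pb])
  · have h1 := sb hu
    have h2 : 0 ≤ u * -f := mul_nonneg hu (neg_nonneg.2 hτ0)
    have h3 : 0 < v := by
      by_contra! h3
      nlinarith [mul_nonneg (neg_nonneg.2 h3) pb.le]
    exact nca (by linarith [mul_pos h3 pa]) (by linarith)

/-- An eel cannot return to the real line between the endpoints of a past arc lying in the upper
half plane. -/
theorem IsInjEelOn.not_return_between {lam : ℝ} {w w' : ℝ → ℂ} {A T a b : ℝ}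
    (h : IsInjEelOn lam w w' A T) (hlam : lam < 1) (hA : A ≤ a) (hab : a < b) (hb : b < T)
    (him : ∀ t ∈ Ioo a b, 0 < (w t).im) (ha : (w a).im = 0) (hb0 : (w b).im = 0)
    (ha' : (w a).re < 0) (hb' : 0 < (w b).re) (hT : w T = 0) : False := by
  obtain ⟨x, hx, hx'⟩ := h.eventually_im_neg hlam hA hab hb him ha hb0 ha' hb' hT
  have hbA : A ≤ b := hA.trans hab.le
  have decr : ∀ p q, A ≤ p → p ≤ q → q ≤ T → (∀ τ ∈ Ico p q, (w' τ).im ≤ 0) →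
      (w q).im ≤ (w p).im := by
    intro p q hp hpq hq hd
    exact image_le_of_deriv_right_le_deriv_boundary (f := fun t => (w t).im)
      (B := fun _ => (w p).im) (B' := fun _ => 0)
      (h.cont_im.mono (Icc_subset_Icc hp hq))
      (fun τ hτ => h.deriv_im ⟨hp.trans hτ.1, hτ.2.trans_le hq⟩) le_rfl continuousOn_const
      (fun τ _ => hasDerivWithinAt_const _ _ _) hd (right_mem_Icc.2 hpq)
  by_cases hτ : ∃ τ ∈ Ioo x T, (w τ).im ≤ 0
  · obtain ⟨τ, hτ, hτ0⟩ := hτ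
    have hAτ : A ≤ τ := hbA.trans (hx.1.trans hτ.1.le)
    have below : ∀ ⦃t⦄, t ∈ Icc τ T → (w t).im ≤ 0 :=
      image_le_of_deriv_right_lt_deriv_boundary (f := fun t => (w t).im)
        (f' := fun t => (w' t).im) (B := fun _ => 0) (B' := fun _ => 0)
        (h.cont_im.mono (Icc_subset_Icc_left hAτ))
        (fun t ht => h.deriv_im ⟨hAτ.trans ht.1, ht.2⟩) hτ0 (fun _ => hasDerivAt_const _ _)
        (fun t ht h0 => hx' t ⟨hτ.1.trans_le ht.1, ht.2⟩ h0.le)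
    have neg : ∀ t ∈ Ico τ T, (w' t).im < 0 := fun t ht =>
      hx' t ⟨hτ.1.trans_le ht.1, ht.2⟩ (below ⟨ht.1, ht.2.le⟩)
    have zero : ∀ t ∈ Icc τ T, (w t).im = 0 := by
      intro t ht
      refine le_antisymm (below ht) ?_
      have := decr t T (hAτ.trans ht.1) ht.2 le_rfl fun s hs =>
        (neg s ⟨ht.1.trans hs.1, hs.2⟩).le
      simpa [hT] using this
    have d1 := h.deriv_im ⟨hAτ, hτ.2⟩
    have d2 : HasDerivWithinAt (fun t => (w t).im) 0 (Ici τ) τ :=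
      (hasDerivWithinAt_const τ (Ici τ) (0 : ℝ)).congr_of_eventuallyEq
        (Filter.mem_of_superset (Icc_mem_nhdsGE hτ.2) zero) (zero τ (left_mem_Icc.2 hτ.2.le))
    have := (uniqueDiffWithinAt_Ici τ).eq_deriv _ d1 d2
    linarith [neg τ (left_mem_Ico.2 hτ.2)]
  · push Not at hτ
    obtain ⟨m, hm⟩ := nonempty_Ioo.2 hx.2
    have hbm : b ≤ m := hx.1.trans hm.1.le
    obtain ⟨c, hc, hc0, hcm⟩ := exists_last_zero hbm
      (h.cont_im.mono (Icc_subset_Icc hbA hm.2.le)) hb0.le (hτ m hm)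
    have hAc : A ≤ c := hbA.trans hc.1
    have hpos : ∀ t ∈ Ioo c T, 0 < (w t).im := by
      intro t ht
      rcases le_or_gt t m with htm | htm
      · exact hcm t ⟨ht.1, htm⟩
      · exact hτ t ⟨hm.1.trans htm, ht.2⟩
    obtain ⟨k, hk, hk'⟩ : ∃ k ∈ Ioo c T, 0 < (w' k).im := by
      by_contra! hn
      have hle : ∀ s ∈ Ioc c m, (w m).im ≤ (w s).im := fun s hs =>
        decr s m (hAc.trans hs.1.le) hs.2 hm.2.le fun τ hτ =>
          hn τ ⟨hs.1.trans_le hτ.1, hτ.2.trans hm.2⟩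
      have ht : Filter.Tendsto (fun t => (w t).im) (nhdsWithin c (Ioi c)) (nhds (w c).im) :=
        (h.cont_im c ⟨hAc, hc.2.le.trans hm.2.le⟩).mono_of_mem_nhdsWithin
          (Filter.mem_of_superset (Ioc_mem_nhdsGT hc.2)
            fun s hs => ⟨hAc.trans hs.1.le, hs.2.trans hm.2.le⟩)
      have := ge_of_tendsto ht (Filter.mem_of_superset (Ioc_mem_nhdsGT hc.2) hle)
      linarith [hτ m hm]
    have hbk : b < k := hc.1.trans_lt hk.1
    refine not_disjoint_arc_and_ray (v := w' k) hab.le hk.2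
      (h.cont.mono (Icc_subset_Icc hA hb.le)) (h.cont.mono (Icc_subset_Icc_left (by linarith)))
      (fun s hs t ht hst => ?_) (fun s hs => ?_) ha hb0
      (fun t ht => hpos t ⟨hk.1.trans_le ht.1, ht.2⟩) hT ha' hb'
      (h.ne k ⟨by linarith, hk.2⟩) hk'.le
      (fun s hs r hr => h.not_mem_ray hlam (hA.trans hs.1) (hs.2.trans_lt hbk) hk.2 hr)
    · have := h.inj ⟨hA.trans hs.1, hs.2.trans hb.le⟩ ⟨by linarith [ht.1], ht.2⟩ hst
      linarith [hs.2, ht.1]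
    · rcases hs.1.eq_or_lt with rfl | h1
      · exact ha.ge
      rcases hs.2.eq_or_lt with rfl | h2
      · exact hb0.ge
      exact (him s ⟨h1, h2⟩).le

theorem IsInjEelOn.not_between_reals {lam : ℝ} {w w' : ℝ → ℂ} {A T B : ℝ}
    (h : IsInjEelOn lam w w' A T) (hlam : lam < 1) (hAB : A < B) (hB : B < T)
    (hA0 : (w A).im = 0) (hB0 : (w B).im = 0) (hA' : (w A).re < 0) (hB' : 0 < (w B).re)
    (hT : w T = 0) : False := by
  obtain ⟨a, b, ha, hab, hb, hfa, hfb, hga, hgb, hne⟩ := exists_consecutive_zeros hAB.le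
    (h.cont_im.mono (Icc_subset_Icc_right hB.le))
    (Complex.continuous_re.comp_continuousOn (h.cont.mono (Icc_subset_Icc_right hB.le)))
    hA0 hB0 hA' hB' (fun t ht h0 h1 => by
      have := h.inj ⟨ht.1, ht.2.trans hB.le⟩ (right_mem_Icc.2 (hAB.trans hB).le)
        ((Complex.ext h1 h0).trans hT.symm)
      linarith [ht.2])
  rcases pos_or_neg_of_ne_zero
    (h.cont_im.mono fun t ht => ⟨ha.trans ht.1.le, ht.2.le.trans (hb.trans hB.le)⟩) hne with hp | hn
  · exact h.not_return_between hlam ha hab (hb.trans_lt hB) hp hfa hfb hga hgb hT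
  · exact (h.map Complex.conjLIE).not_return_between hlam ha hab (hb.trans_lt hB)
      (by simpa using hn) (by simpa using hfa) (by simpa using hfb) (by simpa using hga)
      (by simpa using hgb) (by simp [hT])

theorem lambda_eel_avoids_segment (lam : ℝ) (hlam₁ : -1 ≤ lam) (hlam₂ : lam < 1)
    (I : Set ℝ) (hI : I.OrdConnected)
    (γ γ' : ℝ → EuclideanSpace ℝ (Fin 2))
    (hcont : ContinuousOn γ I)
    (hderiv : ∀ τ ∈ I, HasDerivWithinAt γ (γ' τ) (I ∩ Set.Ici τ) τ)
    (hne : ∀ τ ∈ I, γ' τ ≠ 0)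
    (heel : ∀ t ∈ I, ∀ τ ∈ I, t < τ →
      ⟪γ' τ, γ t - γ τ⟫ ≤ lam * ‖γ' τ‖ * ‖γ t - γ τ‖)
    (hinj : Set.InjOn γ I)
    (t₁ t₂ t₃ : ℝ) (h₁ : t₁ ∈ I) (h₂ : t₂ ∈ I) (h₃ : t₃ ∈ I)
    (h₁₂ : t₁ < t₂) (h₂₃ : t₂ < t₃) :
    γ t₃ ∉ segment ℝ (γ t₁) (γ t₂) := by
  intro hseg
  have hsub : Icc t₁ t₃ ⊆ I := hI.out h₁ h₃
  have hγ : IsInjEelOn lam γ γ' t₁ t₃ :=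
    { cont := hcont.mono hsub
      deriv := fun τ hτ => (hderiv τ (hsub ⟨hτ.1, hτ.2.le⟩)).mono_of_mem_nhdsWithin
        (Filter.mem_of_superset (Icc_mem_nhdsGE hτ.2)
          fun s hs => ⟨hsub ⟨hτ.1.trans hs.1, hs.2⟩, hs.1⟩)
      ne := fun τ hτ => hne τ (hsub ⟨hτ.1, hτ.2.le⟩)
      eel := fun t τ h1 h2 h3 => heel t (hsub ⟨h1, (h2.trans h3).le⟩) τ
        (hsub ⟨h1.trans h2.le, h3.le⟩) h2
      inj := hinj.mono hsub }
  obtain ⟨p, q, hp, hq, hpq, hX⟩ := hseg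
  have hp0 : p ≠ 0 := by
    rintro rfl
    obtain rfl : q = 1 := by linarith
    exact h₂₃.ne (hinj h₂ h₃ (by simpa using hX))
  have hq0 : q ≠ 0 := by
    rintro rfl
    obtain rfl : p = 1 := by linarith
    exact (h₁₂.trans h₂₃).ne (hinj h₁ h₃ (by simpa using hX))
  have hp' : 0 < p := hp.lt_of_ne' hp0
  have hq' : 0 < q := hq.lt_of_ne' hq0
  -- a rotation sending `γ t₂ - γ t₁` to a positive real number
  let L := Complex.orthonormalBasisOneI.repr.symm
  have he : L (γ t₂ - γ t₁) ≠ 0 := by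
    rw [Ne, map_eq_zero_iff _ L.injective, sub_eq_zero]
    exact fun h => h₁₂.ne' (hinj h₂ h₁ h)
  let R := L.trans (rotation (Circle.exp (-(L (γ t₂ - γ t₁)).arg)))
  have hR : R (γ t₂ - γ t₁) = (‖L (γ t₂ - γ t₁)‖ : ℂ) := by
    simp only [R, LinearIsometryEquiv.trans_apply, rotation_apply, Circle.coe_exp]
    conv_lhs => rw [← Complex.norm_mul_exp_arg_mul_I (L (γ t₂ - γ t₁))]
    rw [mul_left_comm, ← Complex.exp_add]
    simp
  have hR1 : R (γ t₁ - γ t₃) = ((-q * ‖L (γ t₂ - γ t₁)‖ : ℝ) : ℂ) := by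
    have : γ t₁ - γ t₃ = (-q) • (γ t₂ - γ t₁) := by
      rw [← hX, show p = 1 - q by linarith]
      module
    rw [this, map_smul, hR, Complex.real_smul]
    push_cast
    rfl
  have hR2 : R (γ t₂ - γ t₃) = ((p * ‖L (γ t₂ - γ t₁)‖ : ℝ) : ℂ) := by
    have : γ t₂ - γ t₃ = p • (γ t₂ - γ t₁) := by
      rw [← hX, show q = 1 - p by linarith]
      module
    rw [this, map_smul, hR, Complex.real_smul]
    push_cast
    rfl
  have hn : 0 < ‖L (γ t₂ - γ t₁)‖ := norm_pos_iff.2 he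
  refine (hγ.map_sub R (γ t₃)).not_between_reals hlam₂ h₁₂ h₂₃ ?_ ?_ ?_ ?_ (by simp)
  · simp only [hR1, Complex.ofReal_im]
  · simp only [hR2, Complex.ofReal_im]
  · simp only [hR1, Complex.ofReal_re]
    nlinarith [mul_pos hq' hn]
  · simp only [hR2, Complex.ofReal_re]
    positivity
end

section
/- Let λ ∈ [−1,1) and let γ : I → ℝ² be an injective λ-eel. Then for every t ∈ I and every nonzero u ∈ K(t), one has ⟨γ'(t), u⟩ ≤ λ‖γ'(t)‖‖u‖; that is, the open cone of half-aperture arccos(λ) directed by the right derivative γ'(t) meets the cone K(t) only at the origin. -/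
open scoped RealInnerProductSpace
open Set

/-- The smallest closed convex cone of `ℝ²` containing `{γ(s) − γ(t) : s ∈ I, s ≤ t}`. -/
def coneK (γ : ℝ → EuclideanSpace ℝ (Fin 2)) (I : Set ℝ) (t : ℝ) :
    Set (EuclideanSpace ℝ (Fin 2)) :=
  ⋂₀ {C : Set (EuclideanSpace ℝ (Fin 2)) |
      IsClosed C ∧ Convex ℝ C ∧ (∀ x ∈ C, ∀ r : ℝ, 0 ≤ r → r • x ∈ C) ∧
      {v | ∃ s ∈ I, s ≤ t ∧ v = γ s - γ t} ⊆ C}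

open Filter Topology

/-- The difference of two determinations of the argument is constant along a curve. -/
theorem arg_div_sub_arg_div_eq {c : ℝ → ℂ} {v w : ℂ} (hv : v ≠ 0) (hw : w ≠ 0) {a b : ℝ}
    (hc : ContinuousOn c (Icc a b)) (hcv : ∀ x ∈ Icc a b, c x / v ∈ Complex.slitPlane)
    (hcw : ∀ x ∈ Icc a b, c x / w ∈ Complex.slitPlane) {p q : ℝ} (hp : p ∈ Icc a b)
    (hq : q ∈ Icc a b) :
    (c p / v).arg - (c q / v).arg = (c p / w).arg - (c q / w).arg := by
  have hcont : ContinuousOn (fun x => (c x / v).arg - (c x / w).arg) (Icc a b) := by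
    intro x hx
    exact ((Complex.continuousAt_arg (hcv x hx)).comp_continuousWithinAt
        (f := fun x => c x / v) ((hc x hx).div_const v)).sub
      ((Complex.continuousAt_arg (hcw x hx)).comp_continuousWithinAt
        (f := fun x => c x / w) ((hc x hx).div_const w))
  have hangle : ∀ x ∈ Icc a b,
      (((c x / v).arg - (c x / w).arg : ℝ) : Real.Angle) = w.arg - v.arg := by
    intro x hx
    have h0 : c x ≠ 0 := fun h => by simpa [h] using hcv x hx
    rw [Real.Angle.coe_sub, Complex.arg_div_coe_angle h0 hv, Complex.arg_div_coe_angle h0 hw]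
    abel
  have hsub : ((fun x => (c x / v).arg - (c x / w).arg) '' Icc a b).Subsingleton := by
    refine (countable_range
      (fun n : ℤ => (c p / v).arg - (c p / w).arg + 2 * Real.pi * n)).isTotallyDisconnected _ ?_
      (isPreconnected_Icc.image _ hcont)
    rintro _ ⟨x, hx, rfl⟩
    obtain ⟨k, hk⟩ := Real.Angle.angle_eq_iff_two_pi_dvd_sub.1
      ((hangle x hx).trans (hangle p hp).symm)
    exact ⟨k, by simp only; linarith⟩
  have := hsub (mem_image_of_mem _ hp) (mem_image_of_mem _ hq)
  linarith

/-- Translating a point of the cone `-μ * ‖z‖ ≤ z.re` by `h > 0` moves it into the slit plane, with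
an error margin proportional to `h`. -/
theorem add_add_mem_slitPlane {μ h : ℝ} {z e : ℂ} (hμ₀ : 0 ≤ μ) (hμ₁ : μ < 1) (hh : 0 < h)
    (hz : -μ * ‖z‖ ≤ z.re) (he : ‖e‖ < h * ((1 - μ) / 2)) :
    z + h + e ∈ Complex.slitPlane := by
  by_contra hcon
  rw [Complex.mem_slitPlane_iff] at hcon
  push Not at hcon
  obtain ⟨hre, him⟩ := hcon
  simp only [Complex.add_re, Complex.ofReal_re] at hre
  have hz' : z = ((z + h + e).re - h : ℝ) - e := by
    apply Complex.ext
    · simp; ring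
    · simp at him ⊢; linarith
  have hnorm : ‖z‖ ≤ (h - (z.re + h + e.re)) + ‖e‖ := by
    calc ‖z‖ = ‖(((z + h + e).re - h : ℝ) : ℂ) - e‖ := congrArg _ hz'
      _ ≤ _ := norm_sub_le _ _
      _ = _ := by
        rw [Complex.norm_real, Real.norm_of_nonpos]
        · simp only [Complex.add_re, Complex.ofReal_re]; ring
        · simp only [Complex.add_re, Complex.ofReal_re]; linarith
  have her := abs_le.1 (Complex.abs_re_le_norm e)
  have h1 := mul_le_mul_of_nonneg_left hnorm hμ₀
  nlinarith [norm_nonneg e, mul_nonneg (sub_nonneg.2 hμ₁.le) (neg_nonneg.2 hre),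
    mul_pos hh (sub_pos.2 hμ₁)]

/-- The oriented angle under which the past points `γ p` and `γ q` are seen from `γ t`,
measured with the branch cut of the argument along `γ' t`. -/
noncomputable def viewAngle (γ γ' : ℝ → ℂ) (p q t : ℝ) : ℝ :=
  ((γ t - γ p) / γ' t).arg - ((γ t - γ q) / γ' t).arg

/-- An injective `λ`-eel in the complex plane. -/
structure IsPlanarEel (lam : ℝ) (I : Set ℝ) (γ γ' : ℝ → ℂ) : Prop where
  ordConnected : I.OrdConnected
  continuousOn : ContinuousOn γ I
  hasDerivWithinAt : ∀ τ ∈ I, HasDerivWithinAt γ (γ' τ) (I ∩ Ici τ) τ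
  deriv_ne_zero : ∀ τ ∈ I, γ' τ ≠ 0
  neg_mul_norm_le_re : ∀ t ∈ I, ∀ τ ∈ I, t < τ →
    -lam * ‖(γ τ - γ t) / γ' τ‖ ≤ ((γ τ - γ t) / γ' τ).re
  injOn : InjOn γ I

namespace IsPlanarEel

variable {lam : ℝ} {I : Set ℝ} {γ γ' : ℝ → ℂ}

theorem div_ne_zero (h : IsPlanarEel lam I γ γ') {s t : ℝ} (hs : s ∈ I) (ht : t ∈ I)
    (hst : s < t) : (γ t - γ s) / γ' t ≠ 0 :=
  _root_.div_ne_zero (sub_ne_zero.2 fun he => hst.ne' (h.injOn ht hs he)) (h.deriv_ne_zero t ht)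

theorem abs_arg_le (h : IsPlanarEel lam I γ γ') {s t : ℝ} (hs : s ∈ I) (ht : t ∈ I) (hst : s < t) :
    |((γ t - γ s) / γ' t).arg| ≤ Real.arccos (-lam) := by
  have h0 := norm_pos_iff.2 (h.div_ne_zero hs ht hst)
  have hre := h.neg_mul_norm_le_re s hs t ht hst
  rw [← Complex.norm_mul_cos_arg, mul_comm] at hre
  have hcos : -lam ≤ Real.cos |((γ t - γ s) / γ' t).arg| := by
    rw [Real.cos_abs]; exact le_of_mul_le_mul_left hre h0
  have := Real.arccos_le_arccos hcos
  rwa [Real.arccos_cos (abs_nonneg _) (Complex.abs_arg_le_pi _)] at this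

theorem mem_slitPlane (h : IsPlanarEel lam I γ γ') (hlam' : lam < 1) {s t : ℝ}
    (hs : s ∈ I) (ht : t ∈ I) (hst : s < t) : (γ t - γ s) / γ' t ∈ Complex.slitPlane := by
  rw [Complex.mem_slitPlane_iff_arg]
  refine ⟨fun hpi => ?_, h.div_ne_zero hs ht hst⟩
  have h1 := h.abs_arg_le hs ht hst
  have h2 : Real.arccos (-lam) < Real.pi := Real.arccos_lt_pi.2 (by linarith)
  rw [hpi, abs_of_pos Real.pi_pos] at h1
  linarith

/-- The slit plane condition on a compact piece of the past is stable in time. -/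
theorem eventually_mem_slitPlane (h : IsPlanarEel lam I γ γ') (hlam' : lam < 1)
    {a b x : ℝ} (ha : a ∈ I) (hx : x ∈ I) (hbx : b < x) :
    ∀ᶠ t in 𝓝[I] x, ∀ s ∈ Icc a b, (γ t - γ s) / γ' x ∈ Complex.slitPlane := by
  have hsub : Icc a b ⊆ I := fun s hs => h.ordConnected.out ha hx ⟨hs.1, hs.2.trans hbx.le⟩
  have hcpt : IsCompact ((fun s => (γ x - γ s) / γ' x) '' Icc a b) :=
    isCompact_Icc.image_of_continuousOn
      ((continuousOn_const.sub (h.continuousOn.mono hsub)).div_const _)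
  obtain ⟨δ, hδ, hthick⟩ := hcpt.exists_thickening_subset_open Complex.isOpen_slitPlane (by
    rintro _ ⟨s, hs, rfl⟩
    exact h.mem_slitPlane hlam' (hsub hs) hx (hs.2.trans_lt hbx))
  have hlim : Tendsto (fun t => γ t / γ' x) (𝓝[I] x) (𝓝 (γ x / γ' x)) :=
    (h.continuousOn x hx).div_const _
  filter_upwards [hlim (Metric.ball_mem_nhds _ hδ)] with t ht s hs
  refine hthick (Metric.mem_thickening_iff.2 ⟨_, mem_image_of_mem _ hs, ?_⟩)
  have ht' : dist (γ t / γ' x) (γ x / γ' x) < δ := ht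
  rw [dist_eq_norm] at ht' ⊢
  convert ht' using 2
  ring

theorem tendsto_slope (h : IsPlanarEel lam I γ γ') {b T : ℝ} (hb : b ∈ I) (hT : T ∈ I)
    (hbT : b < T) :
    Tendsto (fun t => ((t - b : ℝ) : ℂ)⁻¹ * ((γ t - γ b) / γ' b)) (𝓝[>] b) (𝓝 1) := by
  have h1 := (h.hasDerivWithinAt b hb)
  have h2 : HasDerivWithinAt γ (γ' b) (Ioi b) b := by
    refine (h1.mono_of_mem_nhdsWithin ?_)
    filter_upwards [Ioc_mem_nhdsGT hbT] with t ht
    exact ⟨h.ordConnected.out hb hT ⟨ht.1.le, ht.2⟩, ht.1.le⟩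
  rw [hasDerivWithinAt_iff_tendsto_slope' (by simp)] at h2
  have h3 := h2.div_const (γ' b)
  rw [div_self (h.deriv_ne_zero b hb)] at h3
  refine h3.congr fun t => ?_
  rw [slope_def_module, Complex.real_smul]
  push_cast
  ring

/-- Right after time `b` the whole past `[a, b]` stays in the slit plane determined by `γ' b`. -/
theorem eventually_mem_slitPlane_right (h : IsPlanarEel lam I γ γ') (hlam' : lam < 1)
    {a b T : ℝ} (ha : a ∈ I) (hb : b ∈ I) (hT : T ∈ I) (hbT : b < T) :
    ∀ᶠ t in 𝓝[>] b, ∀ s ∈ Icc a b, (γ t - γ s) / γ' b ∈ Complex.slitPlane := by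
  have hμ : max lam 0 < 1 := max_lt hlam' one_pos
  have hball := (h.tendsto_slope hb hT hbT)
    (Metric.ball_mem_nhds 1 (show 0 < (1 - max lam 0) / 2 by linarith))
  filter_upwards [hball, self_mem_nhdsWithin] with t ht (htb : b < t) s hs
  have ht' : dist (((t - b : ℝ) : ℂ)⁻¹ * ((γ t - γ b) / γ' b)) 1 < (1 - max lam 0) / 2 := ht
  have hpos : 0 < t - b := sub_pos.2 htb
  have hne : ((t - b : ℝ) : ℂ) ≠ 0 := by exact_mod_cast hpos.ne'
  have he : ‖(γ t - γ b) / γ' b - (t - b : ℝ)‖ < (t - b) * ((1 - max lam 0) / 2) := by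
    have : (γ t - γ b) / γ' b - (t - b : ℝ) =
        ((t - b : ℝ) : ℂ) * (((t - b : ℝ) : ℂ)⁻¹ * ((γ t - γ b) / γ' b) - 1) := by
      rw [mul_sub, mul_inv_cancel_left₀ hne, mul_one]
    rw [this, norm_mul, Complex.norm_real, Real.norm_of_nonneg hpos.le, ← dist_eq_norm]
    exact mul_lt_mul_of_pos_left ht' hpos
  have hz : -max lam 0 * ‖(γ b - γ s) / γ' b‖ ≤ ((γ b - γ s) / γ' b).re := by
    rcases hs.2.eq_or_lt with rfl | hsb
    · simp
    · refine le_trans ?_ (h.neg_mul_norm_le_re s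
        (h.ordConnected.out ha hb hs) b hb hsb)
      gcongr
      exact le_max_left _ _
  have := add_add_mem_slitPlane (le_max_right _ _) hμ hpos hz he
  convert this using 1
  ring

theorem viewAngle_eq (h : IsPlanarEel lam I γ γ') (hlam' : lam < 1) {a b t p q : ℝ} {v : ℂ}
    (ha : a ∈ I) (ht : t ∈ I) (hbt : b < t) (hv : v ≠ 0)
    (hslit : ∀ s ∈ Icc a b, (γ t - γ s) / v ∈ Complex.slitPlane)
    (hp : p ∈ Icc a b) (hq : q ∈ Icc a b) :
    viewAngle γ γ' p q t = ((γ t - γ p) / v).arg - ((γ t - γ q) / v).arg := by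
  have hsub : Icc a b ⊆ I := fun s hs => h.ordConnected.out ha ht ⟨hs.1, hs.2.trans hbt.le⟩
  exact arg_div_sub_arg_div_eq (c := fun s => γ t - γ s) (h.deriv_ne_zero t ht) hv
    (continuousOn_const.sub (h.continuousOn.mono hsub))
    (fun s hs => h.mem_slitPlane hlam' (hsub hs) ht (hs.2.trans_lt hbt)) hslit hp hq

theorem viewAngle_eventuallyEq (h : IsPlanarEel lam I γ γ') (hlam' : lam < 1) {a b x p q : ℝ}
    (ha : a ∈ I) (hx : x ∈ I) (hbx : b < x) (hp : p ∈ Icc a b) (hq : q ∈ Icc a b) :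
    viewAngle γ γ' p q =ᶠ[𝓝[I] x]
      fun t => ((γ t - γ p) / γ' x).arg - ((γ t - γ q) / γ' x).arg := by
  filter_upwards [h.eventually_mem_slitPlane (a := a) hlam' ha hx hbx, self_mem_nhdsWithin,
    mem_nhdsWithin_of_mem_nhds (Ioi_mem_nhds hbx)] with t ht htI hbt
  exact h.viewAngle_eq hlam' ha htI hbt (h.deriv_ne_zero x hx) ht hp hq

theorem continuousWithinAt_viewAngle (h : IsPlanarEel lam I γ γ') (hlam' : lam < 1)
    {a b x p q : ℝ} (ha : a ∈ I) (hx : x ∈ I) (hbx : b < x) (hp : p ∈ Icc a b)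
    (hq : q ∈ Icc a b) : ContinuousWithinAt (viewAngle γ γ' p q) I x := by
  have hsub : Icc a b ⊆ I := fun s hs => h.ordConnected.out ha hx ⟨hs.1, hs.2.trans hbx.le⟩
  have key : ∀ s ∈ Icc a b, ContinuousWithinAt (fun t => ((γ t - γ s) / γ' x).arg) I x :=
    fun s hs => (Complex.continuousAt_arg
      (h.mem_slitPlane hlam' (hsub hs) hx (hs.2.trans_lt hbx))).comp_continuousWithinAt
        (f := fun t => (γ t - γ s) / γ' x)
        (((h.continuousOn x hx).sub continuousWithinAt_const).div_const _)
  exact ((key p hp).sub (key q hq)).congr_of_eventuallyEq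
    (h.viewAngle_eventuallyEq hlam' ha hx hbx hp hq) rfl

theorem hasDerivWithinAt_viewAngle (h : IsPlanarEel lam I γ γ') (hlam' : lam < 1)
    {a b x p q : ℝ} (ha : a ∈ I) (hx : x ∈ I) (hbx : b < x) (hp : p ∈ Icc a b)
    (hq : q ∈ Icc a b) :
    HasDerivWithinAt (viewAngle γ γ' p q)
      (((γ x - γ p) / γ' x)⁻¹.im - ((γ x - γ q) / γ' x)⁻¹.im) (I ∩ Ici x) x := by
  have hsub : Icc a b ⊆ I := fun s hs => h.ordConnected.out ha hx ⟨hs.1, hs.2.trans hbx.le⟩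
  have key : ∀ s ∈ Icc a b, HasDerivWithinAt (fun t => ((γ t - γ s) / γ' x).arg)
      ((γ x - γ s) / γ' x)⁻¹.im (I ∩ Ici x) x := by
    intro s hs
    have h1 := (((h.hasDerivWithinAt x hx).sub_const (γ s)).div_const (γ' x)).clog_real
      (h.mem_slitPlane hlam' (hsub hs) hx (hs.2.trans_lt hbx))
    rw [div_self (h.deriv_ne_zero x hx), one_div] at h1
    simpa only [Function.comp_def, Complex.imCLM_apply, Complex.log_im] using
      Complex.imCLM.hasFDerivAt.comp_hasDerivWithinAt x h1
  exact ((key p hp).sub (key q hq)).congr_of_eventuallyEq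
    ((h.viewAngle_eventuallyEq hlam' ha hx hbx hp hq).filter_mono
      (nhdsWithin_mono _ inter_subset_left)) rfl

theorem tendsto_viewAngle (h : IsPlanarEel lam I γ γ') (hlam' : lam < 1) {a b T : ℝ}
    (ha : a ∈ I) (hb : b ∈ I) (hT : T ∈ I) (hab : a < b) (hbT : b < T) :
    Tendsto (viewAngle γ γ' a b) (𝓝[>] b) (𝓝 ((γ b - γ a) / γ' b).arg) := by
  have hI : ∀ᶠ t in 𝓝[>] b, t ∈ I := by
    filter_upwards [Ioc_mem_nhdsGT hbT] with t ht
    exact h.ordConnected.out hb hT ⟨ht.1.le, ht.2⟩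
  have hγ : Tendsto γ (𝓝[>] b) (𝓝 (γ b)) :=
    (h.continuousOn b hb).tendsto.mono_left (le_inf nhdsWithin_le_nhds (le_principal_iff.2 hI))
  have h1 : Tendsto (fun t => ((γ t - γ a) / γ' b).arg) (𝓝[>] b)
      (𝓝 ((γ b - γ a) / γ' b).arg) :=
    (Complex.continuousAt_arg (h.mem_slitPlane hlam' ha hb hab)).tendsto.comp
      ((hγ.sub_const _).div_const _)
  have h2 : Tendsto (fun t => ((γ t - γ b) / γ' b).arg) (𝓝[>] b) (𝓝 0) := by
    have := (Complex.continuousAt_arg Complex.one_mem_slitPlane).tendsto.comp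
      (h.tendsto_slope hb hT hbT)
    rw [Complex.arg_one] at this
    refine this.congr' ?_
    filter_upwards [self_mem_nhdsWithin] with t ht
    rw [Function.comp_apply, ← Complex.ofReal_inv,
      Complex.arg_real_mul _ (inv_pos.2 (sub_pos.2 ht))]
  have h3 := h1.sub h2
  rw [sub_zero] at h3
  refine h3.congr' ?_
  filter_upwards [h.eventually_mem_slitPlane_right hlam' ha hb hT hbT, hI,
    self_mem_nhdsWithin] with t ht htI hbt
  exact (h.viewAngle_eq hlam' ha htI hbt (h.deriv_ne_zero b hb) ht ⟨le_rfl, hab.le⟩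
    ⟨hab.le, le_rfl⟩).symm

/-- A view angle larger than `arccos (-λ)` decreases, hence never occurs if it does not occur
initially. -/
theorem viewAngle_le_of_eventually (h : IsPlanarEel lam I γ γ') (hlam' : lam < 1)
    {a b T p q : ℝ} (ha : a ∈ I) (hT : T ∈ I) (hbT : b < T) (hp : p ∈ Icc a b)
    (hq : q ∈ Icc a b)
    (hstart : ∀ c > Real.arccos (-lam), ∀ᶠ t in 𝓝[>] b, viewAngle γ γ' p q t < c) :
    viewAngle γ γ' p q T ≤ Real.arccos (-lam) := by
  have hpi : Real.arccos (-lam) < Real.pi := Real.arccos_lt_pi.2 (by linarith)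
  refine le_of_forall_gt_imp_ge_of_dense fun c hc => ?_
  obtain ⟨t₁, ht₁, hbt₁, ht₁T⟩ := ((hstart c hc).and (Ioo_mem_nhdsGT hbT)).exists
  have hsubT : Icc a T ⊆ I := h.ordConnected.out ha hT
  have hab : a ≤ b := hp.1.trans hp.2
  have hmem : ∀ x ∈ Icc t₁ T, x ∈ I := fun x hx => hsubT ⟨by linarith [hx.1], hx.2⟩
  refine image_le_of_deriv_right_lt_deriv_boundary' (f := viewAngle γ γ' p q)
    (f' := fun x => ((γ x - γ p) / γ' x)⁻¹.im - ((γ x - γ q) / γ' x)⁻¹.im)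
    (B := fun _ => c) (B' := fun _ => 0) (a := t₁) (b := T) ?_ ?_ ht₁.le continuousOn_const
    (fun x _ => hasDerivWithinAt_const _ _ _) ?_ ⟨ht₁T.le, le_rfl⟩
  · exact fun x hx => (h.continuousWithinAt_viewAngle hlam' ha (hmem x hx)
      (hbt₁.trans_le hx.1) hp hq).mono hmem
  · intro x hx
    refine (h.hasDerivWithinAt_viewAngle hlam' ha (hmem x ⟨hx.1, hx.2.le⟩)
      (hbt₁.trans_le hx.1) hp hq).mono_of_mem_nhdsWithin ?_
    filter_upwards [Icc_mem_nhdsGE hx.2] with t ht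
    exact ⟨hmem t ⟨hx.1.trans ht.1, ht.2⟩, ht.1⟩
  · intro x hx hxc
    have hxI := hmem x ⟨hx.1, hx.2.le⟩
    have hbx := hbt₁.trans_le hx.1
    have key : ∀ s ∈ Icc a b, |((γ x - γ s) / γ' x).arg| ≤ Real.arccos (-lam) ∧
        (γ x - γ s) / γ' x ≠ 0 := fun s hs =>
      have hsI := hsubT ⟨hs.1, hs.2.trans hbT.le⟩
      ⟨h.abs_arg_le hsI hxI (hs.2.trans_lt hbx), h.div_ne_zero hsI hxI (hs.2.trans_lt hbx)⟩
    obtain ⟨hp1, hp0⟩ := key p hp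
    obtain ⟨hq1, hq0⟩ := key q hq
    rw [abs_le] at hp1 hq1
    rw [viewAngle] at hxc
    have hqim : ((γ x - γ q) / γ' x).im < 0 := Complex.arg_neg_iff.1 (by linarith)
    have hpim : 0 < ((γ x - γ p) / γ' x).im := by
      refine (Complex.arg_nonneg_iff.1 (by linarith)).lt_of_ne' fun h0 => ?_
      rcases le_or_gt 0 ((γ x - γ p) / γ' x).re with hre | hre
      · linarith [Complex.arg_eq_zero_iff.2 ⟨hre, h0⟩]
      · linarith [Complex.arg_eq_pi_iff.2 ⟨hre, h0⟩]
    have hpn := Complex.normSq_pos.2 hp0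
    have hqn := Complex.normSq_pos.2 hq0
    rw [Complex.inv_im, Complex.inv_im]
    have h1 := div_pos hpim hpn
    have h2 := div_neg_of_neg_of_pos hqim hqn
    rw [neg_div, neg_div]
    linarith

theorem abs_viewAngle_le (h : IsPlanarEel lam I γ γ') (hlam' : lam < 1) {a b T : ℝ}
    (ha : a ∈ I) (hb : b ∈ I) (hT : T ∈ I) (haT : a < T) (hbT : b < T) :
    |viewAngle γ γ' a b T| ≤ Real.arccos (-lam) := by
  have hsymm : ∀ p q t, viewAngle γ γ' p q t = -viewAngle γ γ' q p t := fun p q t => by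
    simp only [viewAngle]; ring
  wlog hab : a < b generalizing a b
  · rcases (not_lt.1 hab).eq_or_lt with rfl | hba
    · simpa [viewAngle] using Real.arccos_nonneg _
    · rw [hsymm, abs_neg]
      exact this hb ha hbT haT hba
  have hlim := h.tendsto_viewAngle hlam' ha hb hT hab hbT
  have hle := abs_le.1 (h.abs_arg_le ha hb hab)
  have hA : a ∈ Icc a b := ⟨le_rfl, hab.le⟩
  have hB : b ∈ Icc a b := ⟨hab.le, le_rfl⟩
  rw [abs_le]
  constructor
  · rw [neg_le, ← hsymm]
    refine h.viewAngle_le_of_eventually hlam' ha hT hbT hB hA fun c hc => ?_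
    filter_upwards [hlim.eventually_const_lt (u := -c) (by linarith)] with t ht
    rw [hsymm]; linarith
  · refine h.viewAngle_le_of_eventually hlam' ha hT hbT hA hB fun c hc => ?_
    exact hlim.eventually_lt_const (by linarith)

/-- The past directions at time `t` lie in a sector that is at most a half-plane. -/
theorem exists_sector (h : IsPlanarEel lam I γ γ') (hlam' : lam < 1) {t : ℝ} (ht : t ∈ I) :
    ∃ c w : ℝ, 0 ≤ w ∧ w ≤ Real.pi / 2 ∧ |c| + w ≤ Real.arccos (-lam) ∧
      ∀ s ∈ I, s < t → |((γ t - γ s) / γ' t).arg - c| ≤ w := by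
  have hpi : Real.arccos (-lam) < Real.pi := Real.arccos_lt_pi.2 (by linarith)
  set κ := Real.arccos (-lam)
  have hκ : 0 ≤ κ := Real.arccos_nonneg _
  set A : Set ℝ := (fun s => ((γ t - γ s) / γ' t).arg) '' (I ∩ Iio t) with hA
  rcases A.eq_empty_or_nonempty with hemp | hne
  · refine ⟨0, 0, le_rfl, by positivity, by simpa using hκ, fun s hs hst => ?_⟩
    exact absurd hemp (Nonempty.ne_empty ⟨_, mem_image_of_mem _ ⟨hs, hst⟩⟩)
  have hbd : ∀ x ∈ A, |x| ≤ κ := by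
    rintro _ ⟨s, ⟨hs, hst⟩, rfl⟩
    exact h.abs_arg_le hs ht hst
  have hbelow : BddBelow A := ⟨-κ, fun x hx => (abs_le.1 (hbd x hx)).1⟩
  have habove : BddAbove A := ⟨κ, fun x hx => (abs_le.1 (hbd x hx)).2⟩
  have hm : -κ ≤ sInf A := le_csInf hne fun x hx => (abs_le.1 (hbd x hx)).1
  have hM : sSup A ≤ κ := csSup_le hne fun x hx => (abs_le.1 (hbd x hx)).2
  have hmM : sInf A ≤ sSup A := csInf_le_csSup hne hbelow habove
  have hdiff : sSup A ≤ sInf A + κ := by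
    refine csSup_le hne fun x hx => ?_
    rw [← sub_le_iff_le_add]
    refine le_csInf hne fun y hy => ?_
    obtain ⟨s, ⟨hs, hst⟩, rfl⟩ := hx
    obtain ⟨s', ⟨hs', hst'⟩, rfl⟩ := hy
    have := (abs_le.1 (h.abs_viewAngle_le hlam' hs hs' ht hst hst')).2
    simp only [viewAngle] at this
    linarith
  refine ⟨(sInf A + sSup A) / 2, (sSup A - sInf A) / 2, by linarith, by linarith, ?_, ?_⟩
  · rw [← le_sub_iff_add_le, abs_le]
    constructor <;> linarith
  · intro s hs hst
    have hsA : ((γ t - γ s) / γ' t).arg ∈ A := mem_image_of_mem _ ⟨hs, hst⟩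
    have h1 := csInf_le hbelow hsA
    have h2 := le_csSup habove hsA
    rw [abs_le]
    constructor <;> linarith

end IsPlanarEel

theorem cos_mul_norm_le_re_of_abs_arg_sub_le {z : ℂ} {c w : ℝ} (hw : w ≤ Real.pi)
    (hz : |z.arg - c| ≤ w) :
    Real.cos w * ‖z‖ ≤ (z * Complex.exp (-c * Complex.I)).re := by
  have hre : (z * Complex.exp (-c * Complex.I)).re = ‖z‖ * Real.cos (z.arg - c) := by
    conv_lhs => rw [← Complex.norm_mul_exp_arg_mul_I z, mul_assoc, ← Complex.exp_add]
    rw [← add_mul, ← Complex.ofReal_neg, ← Complex.ofReal_add, Complex.re_ofReal_mul,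
      Complex.exp_ofReal_mul_I_re, sub_eq_add_neg]
  rw [hre, mul_comm, ← Real.cos_abs (z.arg - c)]
  exact mul_le_mul_of_nonneg_left (Real.cos_le_cos_of_nonneg_of_le_pi (abs_nonneg _) hw hz)
    (norm_nonneg _)

theorem cos_mul_norm_le_re_of_sector {z : ℂ} {c w κ : ℝ} (hw : 0 ≤ w) (hcw : |c| + w ≤ κ)
    (hκ : κ ≤ Real.pi) (hz : Real.cos w * ‖z‖ ≤ (z * Complex.exp (-c * Complex.I)).re) :
    Real.cos κ * ‖z‖ ≤ z.re := by
  rcases eq_or_ne z 0 with rfl | hz0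
  · simp
  set y := z * Complex.exp (-c * Complex.I) with hy
  have hny : ‖y‖ = ‖z‖ := by
    rw [hy, norm_mul, ← Complex.ofReal_neg, Complex.norm_exp_ofReal_mul_I, mul_one]
  have hzy : z = y * Complex.exp (-(-c : ℝ) * Complex.I) := by
    rw [hy, mul_assoc, ← Complex.exp_add]; simp
  have hpos : 0 < ‖z‖ := norm_pos_iff.2 hz0
  rw [← Complex.norm_mul_cos_arg y, hny, mul_comm] at hz
  have hcos : Real.cos w ≤ Real.cos |y.arg| := by
    rw [Real.cos_abs]; exact le_of_mul_le_mul_left hz hpos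
  have hle : |y.arg| ≤ w := by
    have := Real.arccos_le_arccos hcos
    rwa [Real.arccos_cos (abs_nonneg _) (Complex.abs_arg_le_pi _),
      Real.arccos_cos hw (by linarith [abs_nonneg c])] at this
  have := cos_mul_norm_le_re_of_abs_arg_sub_le (z := y) (c := -c) (w := κ) hκ (by
    rw [sub_neg_eq_add]
    exact (abs_add_le _ _).trans (by linarith))
  rwa [← hzy, hny] at this

theorem inner_le_mul_norm_iff {v x : ℂ} (hv : v ≠ 0) (lam : ℝ) :
    ⟪v, x⟫ ≤ lam * ‖v‖ * ‖x‖ ↔ -lam * ‖-x / v‖ ≤ (-x / v).re := by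
  have hpos : 0 < ‖v‖ := norm_pos_iff.2 hv
  have hinner : ⟪v, x⟫ = -(‖v‖ ^ 2 * (-x / v).re) := by
    have : x * (starRingEnd ℂ) v = ((‖v‖ ^ 2 : ℝ) : ℂ) * -(-x / v) := by
      rw [neg_div, neg_neg, ← Complex.normSq_eq_norm_sq, ← Complex.mul_conj]
      field_simp
    rw [Complex.inner, this, Complex.re_ofReal_mul, Complex.neg_re, mul_neg]
  have hnorm : ‖x‖ = ‖v‖ * ‖-x / v‖ := by
    rw [norm_div, norm_neg]; field_simp
  rw [hinner, hnorm]
  constructor <;> intro h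
  · have : 0 < ‖v‖ ^ 2 := by positivity
    nlinarith
  · nlinarith [mul_le_mul_of_nonneg_left h (sq_nonneg ‖v‖)]

theorem mul_norm_le_of_mem_coneK {γ : ℝ → EuclideanSpace ℝ (Fin 2)} {I : Set ℝ} {t k : ℝ}
    (hk : 0 ≤ k) (L : EuclideanSpace ℝ (Fin 2) →L[ℝ] ℂ) (f : ℂ →L[ℝ] ℝ)
    (hγ : ∀ s ∈ I, s < t → k * ‖L (γ s - γ t)‖ ≤ f (L (γ s - γ t)))
    {u : EuclideanSpace ℝ (Fin 2)} (hu : u ∈ coneK γ I t) : k * ‖L u‖ ≤ f (L u) := by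
  refine hu {x | k * ‖L x‖ ≤ f (L x)} ⟨?_, ?_, ?_, ?_⟩
  · exact isClosed_le (by fun_prop) (by fun_prop)
  · intro x hx y hy a b ha hb _
    simp only [mem_ofPred_eq, map_add, map_smul, smul_eq_mul] at hx hy ⊢
    have hn : ‖a • L x + b • L y‖ ≤ a * ‖L x‖ + b * ‖L y‖ := by
      refine (norm_add_le _ _).trans_eq ?_
      rw [norm_smul, norm_smul, Real.norm_of_nonneg ha, Real.norm_of_nonneg hb]
    nlinarith [mul_le_mul_of_nonneg_left hn hk, mul_le_mul_of_nonneg_left hx ha,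
      mul_le_mul_of_nonneg_left hy hb]
  · intro x hx r hr
    simp only [mem_ofPred_eq, map_smul, smul_eq_mul] at hx ⊢
    rw [norm_smul, Real.norm_of_nonneg hr]
    nlinarith [mul_le_mul_of_nonneg_left hx hr]
  · rintro _ ⟨s, hs, hst, rfl⟩
    rcases hst.eq_or_lt with rfl | hst
    · simp
    · exact hγ s hs hst

/-- If `γ : I → ℝ²` is an injective `λ`-eel, then for every `t ∈ I` the
open cone of half-aperture `arccos λ` directed by the right derivative `γ'(t)` meets the
cone `K(t)` only at the origin. -/
theorem planar_lambda_eel_cone_avoids_coneK (lam : ℝ) (hlam₁ : -1 ≤ lam) (hlam₂ : lam < 1)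
    (I : Set ℝ) (hI : I.OrdConnected)
    (γ γ' : ℝ → EuclideanSpace ℝ (Fin 2))
    (hcont : ContinuousOn γ I)
    (hderiv : ∀ τ ∈ I, HasDerivWithinAt γ (γ' τ) (I ∩ Set.Ici τ) τ)
    (hne : ∀ τ ∈ I, γ' τ ≠ 0)
    (heel : ∀ t ∈ I, ∀ τ ∈ I, t < τ →
      ⟪γ' τ, γ t - γ τ⟫ ≤ lam * ‖γ' τ‖ * ‖γ t - γ τ‖)
    (hinj : Set.InjOn γ I)
    (t : ℝ) (ht : t ∈ I)
    (u : EuclideanSpace ℝ (Fin 2)) (hu : u ∈ coneK γ I t) (hu0 : u ≠ 0) :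
    ⟪γ' t, u⟫ ≤ lam * ‖γ' t‖ * ‖u‖ := by
  let e : EuclideanSpace ℝ (Fin 2) ≃ₗᵢ[ℝ] ℂ := Complex.orthonormalBasisOneI.repr.symm
  have hiff : ∀ τ ∈ I, ∀ x, ⟪γ' τ, x⟫ ≤ lam * ‖γ' τ‖ * ‖x‖ ↔
      -lam * ‖-e x / e (γ' τ)‖ ≤ (-e x / e (γ' τ)).re := by
    intro τ hτ x
    rw [← inner_le_mul_norm_iff (by simpa using hne τ hτ), e.inner_map_map, e.norm_map,
      e.norm_map]
  have heel' : IsPlanarEel lam I (e ∘ γ) (e ∘ γ') :=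
    { ordConnected := hI
      continuousOn := e.continuous.comp_continuousOn hcont
      hasDerivWithinAt := fun τ hτ =>
        (e.toContinuousLinearEquiv.toContinuousLinearMap.hasFDerivAt).comp_hasDerivWithinAt τ
          (hderiv τ hτ)
      deriv_ne_zero := fun τ hτ => by simpa using hne τ hτ
      neg_mul_norm_le_re := fun s hs τ hτ hsτ => by
        have := (hiff τ hτ _).1 (heel s hs τ hτ hsτ)
        rwa [map_sub, neg_sub] at this
      injOn := e.injective.comp_injOn hinj }
  obtain ⟨c, w, hw₀, hw, hcw, hsector⟩ := heel'.exists_sector hlam₂ ht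
  rw [hiff t ht]
  let m : ℂ →L[ℝ] ℂ := ContinuousLinearMap.mul ℝ ℂ (-(e (γ' t))⁻¹)
  have hm : ∀ x : ℂ, m x = -x / e (γ' t) := fun x => by
    simp only [m, ContinuousLinearMap.mul_apply']; ring
  have hκ : Real.cos (Real.arccos (-lam)) = -lam :=
    Real.cos_arccos (by linarith) (by linarith)
  have hmem := mul_norm_le_of_mem_coneK (k := Real.cos w)
    (Real.cos_nonneg_of_mem_Icc ⟨by linarith [Real.pi_pos], hw⟩)
    (m.comp e.toContinuousLinearEquiv.toContinuousLinearMap)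
    (Complex.reCLM.comp (ContinuousLinearMap.mul ℝ ℂ (Complex.exp (-c * Complex.I))))
    (fun s hs hst => by
      have := cos_mul_norm_le_re_of_abs_arg_sub_le (by linarith [Real.pi_pos])
        (hsector s hs hst)
      simpa [hm, mul_comm] using this) hu
  rw [← hκ]
  refine cos_mul_norm_le_re_of_sector hw₀ hcw (Real.arccos_le_pi _) ?_
  simpa [hm, mul_comm] using hmem
end

section
/- Let λ ∈ [−1,1) and let γ : I → ℝ² be an injective λ-eel with bounded image. Then γ has finite length: ℓ(γ) < ∞. -/
open scoped RealInnerProductSpace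
open Set

/-- If `f / w`, `g / w'` and `f / g` all avoid the branch cut of the argument on a preconnected
set, then the principal arguments of `f / w` and `g / w'` differ from each other by the principal
argument of `f / g`, up to a constant. -/
lemma arg_div_sub_arg_div_sub_arg_div_eq {f g : ℝ → ℂ} {w w' : ℂ} {S : Set ℝ}
    (hS : IsPreconnected S) (hf : ContinuousOn f S) (hg : ContinuousOn g S)
    (hfw : ∀ x ∈ S, f x / w ∈ Complex.slitPlane) (hgw : ∀ x ∈ S, g x / w' ∈ Complex.slitPlane)
    (hfg : ∀ x ∈ S, f x / g x ∈ Complex.slitPlane) {x y : ℝ} (hx : x ∈ S) (hy : y ∈ S) :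
    (f x / w).arg - (g x / w').arg - (f x / g x).arg =
      (f y / w).arg - (g y / w').arg - (f y / g y).arg := by
  set h : ℝ → ℝ := fun z => (f z / w).arg - (g z / w').arg - (f z / g z).arg with hh
  have hcoe : ∀ z ∈ S, (h z : Real.Angle) = (w'.arg : Real.Angle) - w.arg := by
    intro z hz
    have h1 := Complex.slitPlane_ne_zero (hfw z hz)
    have h2 := Complex.slitPlane_ne_zero (hgw z hz)
    simp only [ne_eq, div_eq_zero_iff, not_or] at h1 h2
    simp only [hh, Real.Angle.coe_sub, Complex.arg_div_coe_angle h1.1 h1.2,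
      Complex.arg_div_coe_angle h2.1 h2.2, Complex.arg_div_coe_angle h1.1 h2.1]
    abel
  have hcont : ContinuousOn (fun z => h z - h y) S := by
    have hg0 : ∀ z ∈ S, g z ≠ 0 := fun z hz h0 =>
      Complex.slitPlane_ne_zero (hgw z hz) (by simp [h0])
    refine ContinuousOn.sub ((ContinuousOn.sub ?_ ?_).sub ?_) continuousOn_const
    · exact Complex.continuousOn_arg.comp (hf.div_const w) hfw
    · exact Complex.continuousOn_arg.comp (hg.div_const w') hgw
    · exact Complex.continuousOn_arg.comp (hf.div hg hg0) hfg
  have hint : ∀ z ∈ S, ∃ k : ℤ, h z - h y = 2 * Real.pi * k := fun z hz =>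
    Real.Angle.angle_eq_iff_two_pi_dvd_sub.1 ((hcoe z hz).trans (hcoe y hy).symm)
  have hord := (hS.image _ hcont).ordConnected
  obtain ⟨k, hk⟩ := hint x hx
  have hxm : h x - h y ∈ (fun z => h z - h y) '' S := ⟨x, hx, rfl⟩
  have hym : (0 : ℝ) ∈ (fun z => h z - h y) '' S := ⟨y, hy, sub_self _⟩
  have hpi := Real.pi_pos
  rcases lt_trichotomy k 0 with hk0 | hk0 | hk0
  · have hk1 : (k : ℝ) ≤ -1 := by exact_mod_cast Int.le_sub_one_of_lt hk0
    obtain ⟨z, hz, hzk⟩ := hord.out hxm hym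
      (show -Real.pi ∈ Icc _ _ from ⟨by rw [hk]; nlinarith, by linarith⟩)
    obtain ⟨l, hl⟩ := hint z hz
    simp only [hl] at hzk
    have : (2 * l : ℝ) = -1 := mul_left_cancel₀ hpi.ne' (by linarith)
    have : 2 * l = -1 := by exact_mod_cast this
    omega
  · rw [hk0] at hk
    simp only [Int.cast_zero, mul_zero] at hk
    exact sub_eq_zero.1 hk
  · have hk1 : (1 : ℝ) ≤ k := by exact_mod_cast hk0
    obtain ⟨z, hz, hzk⟩ := hord.out hym hxm
      (show Real.pi ∈ Icc _ _ from ⟨hpi.le, by rw [hk]; nlinarith⟩)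
    obtain ⟨l, hl⟩ := hint z hz
    simp only [hl] at hzk
    have : (2 * l : ℝ) = 1 := mul_left_cancel₀ hpi.ne' (by linarith)
    have : 2 * l = 1 := by exact_mod_cast this
    omega

lemma mem_slitPlane_of_neg_mul_norm_le_re {lam : ℝ} (hlam : lam < 1) {z : ℂ} (hz : z ≠ 0)
    (h : -(lam * ‖z‖) ≤ z.re) : z ∈ Complex.slitPlane := by
  rw [Complex.mem_slitPlane_iff_not_le_zero]
  intro hle
  obtain ⟨hre, him⟩ := Complex.le_def.1 hle
  have hn : ‖z‖ = -z.re := by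
    rw [← Complex.abs_re_eq_norm.2 (by simpa using him), abs_of_nonpos (by simpa using hre)]
  have : 0 < ‖z‖ := norm_pos_iff.2 hz
  nlinarith

lemma abs_arg_le_arccos {lam : ℝ} {z : ℂ} (hz : z ≠ 0)
    (h : -(lam * ‖z‖) ≤ z.re) : |z.arg| ≤ Real.arccos (-lam) := by
  have hp : 0 < ‖z‖ := norm_pos_iff.2 hz
  rw [← Real.arccos_cos (abs_nonneg z.arg) (Complex.abs_arg_le_pi z), Real.cos_abs,
    Complex.cos_arg hz]
  apply Real.arccos_le_arccos
  rw [le_div_iff₀ hp]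
  linarith

/-- The hypotheses satisfied by an injective planar `lam`-eel, with values in `ℂ`. -/
structure IsPlanarEel_s19 (lam : ℝ) (I : Set ℝ) (γ γ' : ℝ → ℂ) : Prop where
  ordConnected : I.OrdConnected
  continuousOn : ContinuousOn γ I
  hasDerivWithinAt : ∀ τ ∈ I, HasDerivWithinAt γ (γ' τ) (I ∩ Ici τ) τ
  deriv_ne_zero : ∀ τ ∈ I, γ' τ ≠ 0
  inner_le : ∀ t ∈ I, ∀ τ ∈ I, t < τ →
    ⟪γ' τ, γ t - γ τ⟫ ≤ lam * ‖γ' τ‖ * ‖γ t - γ τ‖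
  injOn : InjOn γ I

/-- The angle at time `τ` between the direction of motion and the direction pointing away from
the past position `γ t`. -/
noncomputable def backAngle (γ γ' : ℝ → ℂ) (t τ : ℝ) : ℝ :=
  ((γ τ - γ t) / γ' τ).arg

lemma im_inv_neg_of_arg_pos {z : ℂ} (hz : z ∈ Complex.slitPlane) (h : 0 < z.arg) :
    z⁻¹.im < 0 := by
  rw [← Complex.arg_neg_iff, Complex.arg_inv, if_neg (Complex.mem_slitPlane_iff_arg.1 hz).1]
  linarith

lemma im_inv_pos_of_arg_neg {z : ℂ} (h : z.arg < 0) : 0 < z⁻¹.im := by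
  have him := Complex.arg_neg_iff.1 h
  have hz : z ≠ 0 := by rintro rfl; simp at him
  rw [Complex.inv_im]
  exact div_pos (neg_pos.2 him) (Complex.normSq_pos.2 hz)

lemma inner_exp_mul_div_norm (θ : ℝ) {w : ℂ} (hw : w ≠ 0) (z : ℂ) :
    ⟪Complex.exp (θ * Complex.I) * (w / ‖w‖), z⟫ = ‖z‖ * Real.cos ((z / w).arg - θ) := by
  have hn : ‖w‖ ≠ 0 := norm_ne_zero_iff.2 hw
  have hsq : ‖w‖ ^ 2 = w.re ^ 2 + w.im ^ 2 := by
    rw [← Complex.normSq_eq_norm_sq, Complex.normSq_apply]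
    ring
  obtain ⟨ζ, rfl⟩ : ∃ ζ, z = ζ * w := ⟨z / w, (div_mul_cancel₀ z hw).symm⟩
  rw [mul_div_cancel_right₀ _ hw, norm_mul, Real.cos_sub, Complex.inner]
  have h1 := Complex.norm_mul_cos_arg ζ
  have h2 := Complex.norm_mul_sin_arg ζ
  have h3 : ‖ζ‖ * ‖w‖ * (Real.cos ζ.arg * Real.cos θ + Real.sin ζ.arg * Real.sin θ) =
      ‖w‖ * (ζ.re * Real.cos θ + ζ.im * Real.sin θ) := by
    rw [← h1, ← h2]
    ring
  rw [h3]
  simp only [Complex.mul_re, Complex.mul_im, Complex.conj_re, Complex.conj_im,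
    Complex.exp_ofReal_mul_I_re, Complex.exp_ofReal_mul_I_im, Complex.div_ofReal_re,
    Complex.div_ofReal_im]
  field_simp
  rw [hsq]
  ring

/-- The sum over the directions `u ∈ N` of the maximal past extension in the direction `u`. -/
noncomputable def pastExtent (N : Finset ℂ) (I : Set ℝ) (γ : ℝ → ℂ) (τ : ℝ) : ℝ :=
  ∑ u ∈ N, sSup ((fun t => ⟪u, γ t⟫) '' (I ∩ Iic τ))

namespace IsPlanarEel_s19

variable {lam : ℝ} {I : Set ℝ} {γ γ' : ℝ → ℂ}

lemma sub_ne_zero (h : IsPlanarEel_s19 lam I γ γ') {s τ : ℝ} (hs : s ∈ I) (hτ : τ ∈ I)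
    (hsτ : s < τ) : γ τ - γ s ≠ 0 :=
  _root_.sub_ne_zero.2 fun e => hsτ.ne' (h.injOn hτ hs e)

lemma neg_mul_norm_le_re (h : IsPlanarEel_s19 lam I γ γ') {s τ : ℝ} (hs : s ∈ I) (hτ : τ ∈ I)
    (hsτ : s < τ) :
    -(lam * ‖(γ τ - γ s) / γ' τ‖) ≤ ((γ τ - γ s) / γ' τ).re := by
  have hp : 0 < ‖γ' τ‖ := norm_pos_iff.2 (h.deriv_ne_zero τ hτ)
  have key := h.inner_le s hs τ hτ hsτ
  have hre : ((γ τ - γ s) / γ' τ).re = -⟪γ' τ, γ s - γ τ⟫ / ‖γ' τ‖ ^ 2 := by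
    rw [Complex.div_re, Complex.normSq_eq_norm_sq, Complex.inner]
    simp only [Complex.sub_re, Complex.sub_im, Complex.mul_re, Complex.conj_re, Complex.conj_im]
    ring
  rw [hre, norm_div, le_div_iff₀ (by positivity), norm_sub_rev (γ τ)]
  have : -(lam * (‖γ s - γ τ‖ / ‖γ' τ‖)) * ‖γ' τ‖ ^ 2 = -(lam * ‖γ' τ‖ * ‖γ s - γ τ‖) := by
    field_simp
  linarith

lemma div_mem_slitPlane (h : IsPlanarEel_s19 lam I γ γ') (hlam : lam < 1) {s τ : ℝ} (hs : s ∈ I)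
    (hτ : τ ∈ I) (hsτ : s < τ) : (γ τ - γ s) / γ' τ ∈ Complex.slitPlane :=
  mem_slitPlane_of_neg_mul_norm_le_re hlam
    (div_ne_zero (h.sub_ne_zero hs hτ hsτ) (h.deriv_ne_zero τ hτ))
    (h.neg_mul_norm_le_re hs hτ hsτ)

lemma abs_backAngle_le (h : IsPlanarEel_s19 lam I γ γ') {s τ : ℝ} (hs : s ∈ I)
    (hτ : τ ∈ I) (hsτ : s < τ) : |backAngle γ γ' s τ| ≤ Real.arccos (-lam) :=
  abs_arg_le_arccos
    (div_ne_zero (h.sub_ne_zero hs hτ hsτ) (h.deriv_ne_zero τ hτ))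
    (h.neg_mul_norm_le_re hs hτ hsτ)

/-- Locally around a time `σ > r`, the difference of the back angles to two past points
`γ s`, `γ r` varies like the difference of two continuous arguments. -/
lemma eventually_backAngle_sub_eq (h : IsPlanarEel_s19 lam I γ γ') (hlam : lam < 1) {s r σ : ℝ}
    (hs : s ∈ I) (hr : r ∈ I) (hσ : σ ∈ I) (hsr : s ≤ r) (hrσ : r < σ) :
    ∀ᶠ τ in nhdsWithin σ I, backAngle γ γ' r τ - backAngle γ γ' s τ =
      backAngle γ γ' r σ - backAngle γ γ' s σ + (((γ τ - γ r) / (γ σ - γ r)).arg -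
        ((γ τ - γ s) / (γ σ - γ s)).arg) := by
  have hsub : Icc s r ⊆ I := h.ordConnected.out hs hr
  obtain ⟨x₀, hx₀, hmin⟩ := isCompact_Icc.exists_isMinOn (nonempty_Icc.2 hsr)
    ((continuousOn_const.sub (h.continuousOn.mono hsub)).norm :
      ContinuousOn (fun x => ‖γ σ - γ x‖) (Icc s r))
  have hm : 0 < ‖γ σ - γ x₀‖ :=
    norm_pos_iff.2 (h.sub_ne_zero (hsub hx₀) hσ (hx₀.2.trans_lt hrσ))
  have hclose : ∀ᶠ τ in nhdsWithin σ I, ‖γ τ - γ σ‖ < ‖γ σ - γ x₀‖ := by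
    have := Metric.tendsto_nhds.1 (h.continuousOn σ hσ) _ hm
    simpa only [dist_eq_norm] using this
  filter_upwards [hclose, self_mem_nhdsWithin, mem_nhdsWithin_of_mem_nhds (Ioi_mem_nhds hrσ)]
    with τ hτ hτI hrτ
  have key := arg_div_sub_arg_div_sub_arg_div_eq (f := fun x => γ τ - γ x)
    (g := fun x => γ σ - γ x) (w := γ' τ) (w' := γ' σ) (S := Icc s r)
    isPreconnected_Icc
    (continuousOn_const.sub (h.continuousOn.mono hsub))
    (continuousOn_const.sub (h.continuousOn.mono hsub))
    (fun x hx => h.div_mem_slitPlane hlam (hsub hx) hτI (hx.2.trans_lt hrτ))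
    (fun x hx => h.div_mem_slitPlane hlam (hsub hx) hσ (hx.2.trans_lt hrσ))
    (fun x hx => by
      have h0 := h.sub_ne_zero (hsub hx) hσ (hx.2.trans_lt hrσ)
      have e : (γ τ - γ x) / (γ σ - γ x) = 1 + (γ τ - γ σ) / (γ σ - γ x) := by
        field_simp
        ring
      rw [e]
      apply Complex.mem_slitPlane_of_norm_lt_one
      rw [norm_div, div_lt_one (norm_pos_iff.2 h0)]
      exact hτ.trans_le (hmin hx))
    (right_mem_Icc.2 hsr) (left_mem_Icc.2 hsr)
  simp only [backAngle]
  linarith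

lemma continuousWithinAt_backAngle_sub (h : IsPlanarEel_s19 lam I γ γ') (hlam : lam < 1)
    {s r σ : ℝ} (hs : s ∈ I) (hr : r ∈ I) (hσ : σ ∈ I) (hsr : s ≤ r) (hrσ : r < σ) :
    ContinuousWithinAt (fun τ => backAngle γ γ' r τ - backAngle γ γ' s τ) I σ := by
  have aux : ∀ x ∈ I, x < σ →
      ContinuousWithinAt (fun τ => ((γ τ - γ x) / (γ σ - γ x)).arg) I σ := by
    intro x hx hxσ
    have h0 := h.sub_ne_zero hx hσ hxσ
    have hc : ContinuousWithinAt (fun τ => (γ τ - γ x) / (γ σ - γ x)) I σ :=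
      ((h.continuousOn σ hσ).sub continuousWithinAt_const).div_const _
    refine ContinuousAt.comp_continuousWithinAt (g := Complex.arg) (Complex.continuousAt_arg ?_) hc
    rw [div_self h0]
    exact Complex.one_mem_slitPlane
  refine ContinuousWithinAt.congr_of_eventuallyEq
    (continuousWithinAt_const.add ((aux r hr hrσ).sub (aux s hs (hsr.trans_lt hrσ))))
    (h.eventually_backAngle_sub_eq hlam hs hr hσ hsr hrσ) ?_
  have h1 := h.sub_ne_zero hr hσ hrσ
  have h2 := h.sub_ne_zero hs hσ (hsr.trans_lt hrσ)
  simp [div_self h1, div_self h2]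

lemma hasDerivWithinAt_backAngle_sub (h : IsPlanarEel_s19 lam I γ γ') (hlam : lam < 1)
    {s r σ : ℝ} (hs : s ∈ I) (hr : r ∈ I) (hσ : σ ∈ I) (hsr : s ≤ r) (hrσ : r < σ) :
    HasDerivWithinAt (fun τ => backAngle γ γ' r τ - backAngle γ γ' s τ)
      ((((γ σ - γ r) / γ' σ)⁻¹).im - (((γ σ - γ s) / γ' σ)⁻¹).im) (I ∩ Ici σ) σ := by
  have aux : ∀ x ∈ I, x < σ →
      HasDerivWithinAt (fun τ => ((γ τ - γ x) / (γ σ - γ x)).arg)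
        (((γ σ - γ x) / γ' σ)⁻¹).im (I ∩ Ici σ) σ := by
    intro x hx hxσ
    have h0 := h.sub_ne_zero hx hσ hxσ
    have hd : HasDerivWithinAt (fun τ => (γ τ - γ x) / (γ σ - γ x)) (γ' σ / (γ σ - γ x))
        (I ∩ Ici σ) σ := ((h.hasDerivWithinAt σ hσ).sub_const _).div_const _
    have hlog := hd.clog_real (by rw [div_self h0]; exact Complex.one_mem_slitPlane)
    have := Complex.imCLM.hasFDerivAt.comp_hasDerivWithinAt σ hlog
    simpa [Function.comp_def, div_self h0, Complex.log_im] using this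
  refine HasDerivWithinAt.congr_of_eventuallyEq
    (((aux r hr hrσ).sub (aux s hs (hsr.trans_lt hrσ))).const_add _)
    ((h.eventually_backAngle_sub_eq hlam hs hr hσ hsr hrσ).filter_mono
      (nhdsWithin_mono _ inter_subset_left)) ?_
  have h1 := h.sub_ne_zero hr hσ hrσ
  have h2 := h.sub_ne_zero hs hσ (hsr.trans_lt hrσ)
  simp [div_self h1, div_self h2]

lemma tendsto_slope_s19 (h : IsPlanarEel_s19 lam I γ γ') {r b : ℝ} (hr : r ∈ I) (hb : b ∈ I)
    (hrb : r < b) : Filter.Tendsto (slope γ r) (nhdsWithin r (Ioi r)) (nhds (γ' r)) := by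
  refine (hasDerivWithinAt_iff_tendsto_slope' self_notMem_Ioi).1
    ((h.hasDerivWithinAt r hr).mono_of_mem_nhdsWithin ?_)
  filter_upwards [Ioc_mem_nhdsGT hrb] with x hx
  exact ⟨h.ordConnected.out hr hb ⟨hx.1.le, hx.2⟩, hx.1.le⟩

/-- Shortly after time `r`, the curve moves in a direction which is outside of the cone around
`γ' r` forbidden for the past. -/
lemma eventually_lt_inner (h : IsPlanarEel_s19 lam I γ γ') {μ : ℝ} (hμ : μ < 1) {r b : ℝ}
    (hr : r ∈ I) (hb : b ∈ I) (hrb : r < b) :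
    ∀ᶠ τ in nhdsWithin r (Ioi r), μ * ‖γ' r‖ * ‖γ τ - γ r‖ < ⟪γ' r, γ τ - γ r⟫ := by
  have hslope := h.tendsto_slope_s19 hr hb hrb
  have hp : 0 < ‖γ' r‖ := norm_pos_iff.2 (h.deriv_ne_zero r hr)
  have h1 : Filter.Tendsto (fun τ => μ * ‖γ' r‖ * ‖slope γ r τ‖) (nhdsWithin r (Ioi r))
      (nhds (μ * ‖γ' r‖ * ‖γ' r‖)) := hslope.norm.const_mul _
  have h2 : Filter.Tendsto (fun τ => ⟪γ' r, slope γ r τ⟫) (nhdsWithin r (Ioi r))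
      (nhds ⟪γ' r, γ' r⟫) := tendsto_const_nhds.inner hslope
  have hlt : μ * ‖γ' r‖ * ‖γ' r‖ < ⟪γ' r, γ' r⟫ := by
    rw [real_inner_self_eq_norm_sq]
    nlinarith [mul_pos hp hp]
  filter_upwards [h1.eventually_lt h2 hlt, self_mem_nhdsWithin] with τ hτ hrτ
  have hpos : 0 < τ - r := sub_pos.2 hrτ
  rw [slope_def_module, inner_smul_right, norm_smul, Real.norm_of_nonneg (by positivity)] at hτ
  have e : γ τ - γ r = (τ - r) • ((τ - r)⁻¹ • (γ τ - γ r)) := by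
    rw [smul_smul, mul_inv_cancel₀ hpos.ne', one_smul]
  have := mul_lt_mul_of_pos_left hτ hpos
  have e1 : (τ - r) * (μ * ‖γ' r‖ * ((τ - r)⁻¹ * ‖γ τ - γ r‖)) =
      μ * ‖γ' r‖ * ‖γ τ - γ r‖ := by field_simp
  have e2 : (τ - r) * ((τ - r)⁻¹ * ⟪γ' r, γ τ - γ r⟫) = ⟪γ' r, γ τ - γ r⟫ := by field_simp
  rwa [e1, e2] at this

/-- Shortly after time `r`, the difference of the back angles to `γ s` and `γ r` is close to
the back angle to `γ s` at time `r`. -/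
lemma tendsto_backAngle_sub (h : IsPlanarEel_s19 lam I γ γ') (hlam : lam < 1) {s r b : ℝ}
    (hs : s ∈ I) (hr : r ∈ I) (hb : b ∈ I) (hsr : s < r) (hrb : r < b) :
    Filter.Tendsto (fun τ => backAngle γ γ' r τ - backAngle γ γ' s τ)
      (nhdsWithin r (Ioi r)) (nhds (-backAngle γ γ' s r)) := by
  have hsub : Icc s r ⊆ I := h.ordConnected.out hs hr
  have hIoc : Ioc r b ⊆ I := fun x hx => h.ordConnected.out hr hb ⟨hx.1.le, hx.2⟩
  have hmem := Ioc_mem_nhdsGT hrb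
  have hlim : Filter.Tendsto (fun τ => (γ τ - γ s) / slope γ r τ) (nhdsWithin r (Ioi r))
      (nhds ((γ r - γ s) / γ' r)) := by
    refine Filter.Tendsto.div ?_ (h.tendsto_slope_s19 hr hb hrb) (h.deriv_ne_zero r hr)
    refine Filter.Tendsto.sub_const ?_ _
    exact (h.continuousOn r hr).mono_left
      (nhdsWithin_le_iff.2 (Filter.mem_of_superset hmem hIoc))
  have hlim' := (((Complex.continuousAt_arg (h.div_mem_slitPlane hlam hs hr hsr)).tendsto).comp
    hlim).neg
  refine hlim'.congr' ?_
  filter_upwards [hmem, h.eventually_lt_inner hlam hr hb hrb] with τ hτ hfree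
  have hτI := hIoc hτ
  have hτr := h.sub_ne_zero hr hτI hτ.1
  have hfg : ∀ x ∈ Icc s r, (γ τ - γ x) / (γ τ - γ r) ∈ Complex.slitPlane := by
    intro x hx
    rcases hx.2.eq_or_lt with rfl | hxr
    · rw [div_self hτr]
      exact Complex.one_mem_slitPlane
    rw [Complex.mem_slitPlane_iff_not_le_zero]
    intro hle
    obtain ⟨hre, him⟩ := Complex.le_def.1 hle
    obtain ⟨k, hk⟩ : ∃ k : ℝ, (γ τ - γ x) / (γ τ - γ r) = k :=
      ⟨_, Complex.ext rfl (by simpa using him)⟩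
    rw [hk] at hre
    have hk0 : k ≤ 0 := by simpa using hre
    have hx' : γ x - γ r = (1 - k) • (γ τ - γ r) := by
      rw [div_eq_iff hτr] at hk
      rw [Complex.real_smul]
      push_cast
      linear_combination -hk
    have := h.inner_le x (hsub hx) r hr hxr
    rw [hx', inner_smul_right, norm_smul, Real.norm_of_nonneg (by linarith)] at this
    nlinarith
  have key := arg_div_sub_arg_div_sub_arg_div_eq (f := fun x => γ τ - γ x)
    (g := fun _ => γ τ - γ r) (w := γ' τ) (w' := γ τ - γ r) (S := Icc s r)
    isPreconnected_Icc
    (continuousOn_const.sub (h.continuousOn.mono hsub)) continuousOn_const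
    (fun x hx => h.div_mem_slitPlane hlam (hsub hx) hτI (hx.2.trans_lt hτ.1))
    (fun x hx => by rw [div_self hτr]; exact Complex.one_mem_slitPlane)
    hfg (right_mem_Icc.2 hsr.le) (left_mem_Icc.2 hsr.le)
  have hscale : ((γ τ - γ s) / slope γ r τ).arg = ((γ τ - γ s) / (γ τ - γ r)).arg := by
    have hpos : 0 < τ - r := sub_pos.2 hτ.1
    rw [← Complex.arg_real_mul ((γ τ - γ s) / (γ τ - γ r)) hpos, slope_def_module,
      Complex.real_smul]
    congr 1
    push_cast
    rw [div_mul_eq_div_div, div_inv_eq_mul]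
    ring
  simp only [Function.comp_apply, hscale, backAngle]
  simp only [div_self hτr, Complex.arg_one] at key
  linarith

/-- The back angles at a given time differ by at most `arccos (-lam)`. -/
lemma abs_backAngle_sub_le (h : IsPlanarEel_s19 lam I γ γ') (hlam : lam < 1) {s r b : ℝ}
    (hs : s ∈ I) (hr : r ∈ I) (hb : b ∈ I) (hsr : s < r) (hrb : r < b) :
    |backAngle γ γ' r b - backAngle γ γ' s b| ≤ Real.arccos (-lam) := by
  refine le_of_forall_pos_le_add fun ε hε => ?_
  set D : ℝ → ℝ := fun τ => backAngle γ γ' r τ - backAngle γ γ' s τ with hD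
  set D' : ℝ → ℝ := fun τ => (((γ τ - γ r) / γ' τ)⁻¹).im - (((γ τ - γ s) / γ' τ)⁻¹).im with hD'
  have hinit : ∀ᶠ τ in nhdsWithin r (Ioi r), |D τ| < Real.arccos (-lam) + ε := by
    have := (h.tendsto_backAngle_sub hlam hs hr hb hsr hrb).abs
    refine this.eventually_lt_const ?_
    rw [abs_neg]
    linarith [h.abs_backAngle_le hs hr hsr]
  obtain ⟨a, ha, hab⟩ := (hinit.and (Ioo_mem_nhdsGT hrb)).exists
  have hI : Icc a b ⊆ I := fun x hx => h.ordConnected.out hr hb ⟨hab.1.le.trans hx.1, hx.2⟩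
  have hgt : ∀ x ∈ Icc a b, r < x := fun x hx => hab.1.trans_le hx.1
  have hcont : ContinuousOn D (Icc a b) := fun x hx =>
    (h.continuousWithinAt_backAngle_sub hlam hs hr (hI hx) hsr.le (hgt x hx)).mono hI
  have hder : ∀ x ∈ Ico a b, HasDerivWithinAt D (D' x) (Ici x) x := by
    intro x hx
    have hx' := Ico_subset_Icc_self hx
    refine (h.hasDerivWithinAt_backAngle_sub hlam hs hr (hI hx') hsr.le
      (hgt x hx')).mono_of_mem_nhdsWithin ?_
    filter_upwards [Icc_mem_nhdsGE hx.2] with y hy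
    exact ⟨hI ⟨hx.1.trans hy.1, hy.2⟩, hy.1⟩
  have hbound : ∀ x ∈ Ico a b, ∀ t ∈ I, t < x → |backAngle γ γ' t x| ≤ Real.arccos (-lam) :=
    fun x hx t ht htx => h.abs_backAngle_le ht (hI (Ico_subset_Icc_self hx)) htx
  have hslit : ∀ x ∈ Ico a b, ∀ t ∈ I, t < x → (γ x - γ t) / γ' x ∈ Complex.slitPlane :=
    fun x hx t ht htx => h.div_mem_slitPlane hlam ht (hI (Ico_subset_Icc_self hx)) htx
  have hbm : b ∈ Icc a b := right_mem_Icc.2 hab.2.le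
  rw [abs_lt] at ha
  rw [abs_le]
  constructor
  · have := image_le_of_deriv_right_lt_deriv_boundary' (f := fun x => -D x)
      (f' := fun x => -D' x) (B := fun _ => Real.arccos (-lam) + ε) (B' := fun _ => 0)
      hcont.neg (fun x hx => (hder x hx).neg) (by linarith [ha.1]) continuousOn_const
      (fun x _ => hasDerivWithinAt_const _ _ _) (fun x hx hxe => ?_) hbm
    · simp only [hD] at this
      linarith
    · have hrx := hgt x (Ico_subset_Icc_self hx)
      have h1 := abs_le.1 (hbound x hx r hr hrx)
      have h2 := abs_le.1 (hbound x hx s hs (hsr.trans hrx))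
      simp only [hD] at hxe
      have h3 := im_inv_neg_of_arg_pos (hslit x hx s hs (hsr.trans hrx))
        (show 0 < backAngle γ γ' s x by linarith)
      have h4 := im_inv_pos_of_arg_neg (show backAngle γ γ' r x < 0 by linarith)
      simp only [hD']
      linarith
  · have := image_le_of_deriv_right_lt_deriv_boundary' (f := D)
      (f' := D') (B := fun _ => Real.arccos (-lam) + ε) (B' := fun _ => 0)
      hcont hder ha.2.le continuousOn_const
      (fun x _ => hasDerivWithinAt_const _ _ _) (fun x hx hxe => ?_) hbm
    · exact this
    · have hrx := hgt x (Ico_subset_Icc_self hx)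
      have h1 := abs_le.1 (hbound x hx r hr hrx)
      have h2 := abs_le.1 (hbound x hx s hs (hsr.trans hrx))
      simp only [hD] at hxe
      have h3 := im_inv_neg_of_arg_pos (hslit x hx r hr hrx)
        (show 0 < backAngle γ γ' r x by linarith)
      have h4 := im_inv_pos_of_arg_neg (show backAngle γ γ' s x < 0 by linarith)
      simp only [hD']
      linarith

/-- The directions pointing away from the past positions lie in a convex cone. -/
lemma exists_cos_mul_norm_le_inner (h : IsPlanarEel_s19 lam I γ γ') (hlam : lam < 1) {τ : ℝ}
    (hτ : τ ∈ I) : ∃ v : ℂ, ‖v‖ = 1 ∧ ∀ s ∈ I, s < τ →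
      Real.cos (Real.arccos (-lam) / 2) * ‖γ τ - γ s‖ ≤ ⟪v, γ τ - γ s⟫ := by
  set L := Real.arccos (-lam) with hL
  have hL0 : 0 ≤ L := Real.arccos_nonneg _
  have hLpi : L ≤ Real.pi := Real.arccos_le_pi _
  set A := (fun s => backAngle γ γ' s τ) '' (I ∩ Iio τ) with hA
  have hdiff : ∀ s ∈ I ∩ Iio τ, ∀ r ∈ I ∩ Iio τ,
      backAngle γ γ' r τ ≤ backAngle γ γ' s τ + L := by
    intro s hs r hr
    rcases lt_trichotomy s r with hsr | rfl | hrs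
    · linarith [(abs_le.1 (h.abs_backAngle_sub_le hlam hs.1 hr.1 hτ hsr hr.2)).2]
    · linarith
    · linarith [(abs_le.1 (h.abs_backAngle_sub_le hlam hr.1 hs.1 hτ hrs hs.2)).1]
  have hw := h.deriv_ne_zero τ hτ
  have hn : ‖γ' τ‖ ≠ 0 := norm_ne_zero_iff.2 hw
  refine ⟨Complex.exp ((sSup A - L / 2 : ℝ) * Complex.I) * (γ' τ / ‖γ' τ‖), ?_, ?_⟩
  · rw [norm_mul, Complex.norm_exp_ofReal_mul_I, norm_div, Complex.norm_real, norm_norm,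
      div_self hn, one_mul]
  · intro s hs hsτ
    have hbdd : BddAbove A := ⟨backAngle γ γ' s τ + L, by
      rintro _ ⟨r, hr, rfl⟩
      exact hdiff s ⟨hs, hsτ⟩ r hr⟩
    have hle : backAngle γ γ' s τ ≤ sSup A := le_csSup hbdd ⟨s, ⟨hs, hsτ⟩, rfl⟩
    have hge : sSup A ≤ backAngle γ γ' s τ + L := by
      refine csSup_le ⟨_, s, ⟨hs, hsτ⟩, rfl⟩ ?_
      rintro _ ⟨r, hr, rfl⟩
      exact hdiff s ⟨hs, hsτ⟩ r hr
    rw [inner_exp_mul_div_norm _ hw, mul_comm]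
    refine mul_le_mul_of_nonneg_left ?_ (norm_nonneg _)
    rw [← Real.cos_abs (_ - _)]
    refine Real.cos_le_cos_of_nonneg_of_le_pi (abs_nonneg _) (by linarith) ?_
    change |backAngle γ γ' s τ - _| ≤ _
    rw [abs_le]
    constructor <;> linarith

/-- Shortly after time `τ`, the distance to the past is at least a fixed proportion of the
distance to `γ τ`. -/
lemma eventually_mul_norm_le (h : IsPlanarEel_s19 lam I γ γ') {μ : ℝ} (hμ : lam < μ)
    {τ b : ℝ} (hτ : τ ∈ I) (hb : b ∈ I) (hτb : τ < b) :
    ∀ᶠ σ in nhdsWithin τ (Ioi τ), ∀ s ∈ I, s ≤ τ →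
      Real.sqrt (1 - μ ^ 2) * ‖γ σ - γ τ‖ ≤ ‖γ σ - γ s‖ := by
  have hslope := h.tendsto_slope_s19 hτ hb hτb
  have hp : 0 < ‖γ' τ‖ := norm_pos_iff.2 (h.deriv_ne_zero τ hτ)
  have h1 : Filter.Tendsto (fun σ => lam * ‖γ' τ‖ + ‖slope γ τ σ - γ' τ‖)
      (nhdsWithin τ (Ioi τ)) (nhds (lam * ‖γ' τ‖ + ‖γ' τ - γ' τ‖)) :=
    (hslope.sub_const _).norm.const_add _
  have h2 : Filter.Tendsto (fun σ => μ * ‖slope γ τ σ‖) (nhdsWithin τ (Ioi τ))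
      (nhds (μ * ‖γ' τ‖)) := hslope.norm.const_mul _
  have hlt : lam * ‖γ' τ‖ + ‖γ' τ - γ' τ‖ < μ * ‖γ' τ‖ := by
    rw [sub_self, norm_zero, add_zero]
    exact mul_lt_mul_of_pos_right hμ hp
  filter_upwards [h1.eventually_lt h2 hlt, self_mem_nhdsWithin] with σ hσ hτσ s hs hsτ
  have hpos : 0 < σ - τ := _root_.sub_pos.2 hτσ
  have hinner : ⟪γ s - γ τ, slope γ τ σ⟫ ≤ μ * ‖γ s - γ τ‖ * ‖slope γ τ σ‖ := by
    have e1 : ⟪γ s - γ τ, γ' τ⟫ ≤ lam * ‖γ' τ‖ * ‖γ s - γ τ‖ := by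
      rcases hsτ.eq_or_lt with rfl | hsτ
      · simp
      · rw [real_inner_comm]
        exact h.inner_le s hs τ hτ hsτ
    have e2 := real_inner_le_norm (γ s - γ τ) (slope γ τ σ - γ' τ)
    rw [inner_sub_right] at e2
    nlinarith [norm_nonneg (γ s - γ τ)]
  have hδ : γ σ - γ τ = (σ - τ) • slope γ τ σ := by
    rw [slope_def_module, smul_smul, mul_inv_cancel₀ hpos.ne', one_smul]
  have hinner' : ⟪γ s - γ τ, γ σ - γ τ⟫ ≤ μ * ‖γ s - γ τ‖ * ‖γ σ - γ τ‖ := by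
    rw [hδ, inner_smul_right, norm_smul, Real.norm_of_nonneg hpos.le]
    nlinarith
  have hexp : ‖γ σ - γ s‖ ^ 2 =
      ‖γ σ - γ τ‖ ^ 2 - 2 * ⟪γ s - γ τ, γ σ - γ τ⟫ + ‖γ s - γ τ‖ ^ 2 := by
    rw [← sub_sub_sub_cancel_right (γ σ) (γ s) (γ τ), norm_sub_sq_real, real_inner_comm]
  refine le_of_sq_le_sq ?_ (norm_nonneg _)
  rw [mul_pow, hexp]
  rcases le_total 0 (1 - μ ^ 2) with h0 | h0
  · rw [Real.sq_sqrt h0]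
    nlinarith [sq_nonneg (‖γ s - γ τ‖ - μ * ‖γ σ - γ τ‖)]
  · rw [Real.sqrt_eq_zero_of_nonpos h0, ← hexp, zero_pow two_ne_zero, zero_mul]
    exact sq_nonneg _

/-- Shortly after any time `τ`, the past extent in finitely many directions forming a fine enough
net grows at least proportionally to the distance travelled. -/
lemma exists_mul_norm_sub_le_pastExtent_sub (h : IsPlanarEel_s19 lam I γ γ') (hlam : lam < 1)
    {μ κ : ℝ} (hμ : lam < μ) (hκ : κ ≤ Real.cos (Real.arccos (-lam) / 2) / 2)
    (hκ0 : 0 ≤ κ) {N : Finset ℂ}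
    (hN : ∀ v : ℂ, ‖v‖ = 1 → ∃ u ∈ N, ‖v - u‖ ≤ κ)
    (hbdd : ∀ u ∈ N, BddAbove ((fun t => ⟪u, γ t⟫) '' I)) {τ b : ℝ} (hτ : τ ∈ I) (hb : b ∈ I)
    (hτb : τ < b) : ∃ σ ∈ Ioc τ b,
      κ * Real.sqrt (1 - μ ^ 2) * ‖γ σ - γ τ‖ ≤ pastExtent N I γ σ - pastExtent N I γ τ := by
  obtain ⟨σ, hfar, hσ⟩ :=
    ((h.eventually_mul_norm_le hμ hτ hb hτb).and (Ioc_mem_nhdsGT hτb)).exists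
  refine ⟨σ, hσ, ?_⟩
  have hσI : σ ∈ I := h.ordConnected.out hτ hb ⟨hσ.1.le, hσ.2⟩
  obtain ⟨v, hv, hcone⟩ := h.exists_cos_mul_norm_le_inner hlam hσI
  obtain ⟨u, hu, huv⟩ := hN v hv
  have hbdd' : ∀ w ∈ N, BddAbove ((fun t => ⟪w, γ t⟫) '' (I ∩ Iic σ)) := fun w hw =>
    (hbdd w hw).mono (image_mono inter_subset_left)
  have hdir : ∀ s ∈ I, s ≤ τ →
      ⟪u, γ s⟫ ≤ ⟪u, γ σ⟫ - κ * Real.sqrt (1 - μ ^ 2) * ‖γ σ - γ τ‖ := by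
    intro s hs hsτ
    have h1 := hcone s hs (hsτ.trans_lt hσ.1)
    have h2 := real_inner_le_norm (v - u) (γ σ - γ s)
    rw [inner_sub_left, inner_sub_right u] at h2
    nlinarith [hfar s hs hsτ, norm_nonneg (γ σ - γ s)]
  rw [pastExtent, pastExtent, ← Finset.sum_sub_distrib]
  have hterm : ∀ w ∈ N, 0 ≤ sSup ((fun t => ⟪w, γ t⟫) '' (I ∩ Iic σ)) -
      sSup ((fun t => ⟪w, γ t⟫) '' (I ∩ Iic τ)) := fun w hw =>
    sub_nonneg.2 (csSup_le_csSup (hbdd' w hw) ⟨_, τ, ⟨hτ, self_mem_Iic⟩, rfl⟩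
      (image_mono (inter_subset_inter_right _ (Iic_subset_Iic.2 hσ.1.le))))
  refine le_trans ?_ (Finset.single_le_sum hterm hu)
  have hup : ⟪u, γ σ⟫ ≤ sSup ((fun t => ⟪u, γ t⟫) '' (I ∩ Iic σ)) :=
    le_csSup (hbdd' u hu) ⟨σ, ⟨hσI, self_mem_Iic⟩, rfl⟩
  have hlow : sSup ((fun t => ⟪u, γ t⟫) '' (I ∩ Iic τ)) ≤
      ⟪u, γ σ⟫ - κ * Real.sqrt (1 - μ ^ 2) * ‖γ σ - γ τ‖ := by
    refine csSup_le ⟨_, τ, ⟨hτ, self_mem_Iic⟩, rfl⟩ ?_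
    rintro _ ⟨s, hs, rfl⟩
    exact hdir s hs.1 hs.2
  linarith

end IsPlanarEel_s19

lemma monotoneOn_pastExtent {N : Finset ℂ} {I : Set ℝ} {γ : ℝ → ℂ}
    (hbdd : ∀ u ∈ N, BddAbove ((fun t => ⟪u, γ t⟫) '' I)) : MonotoneOn (pastExtent N I γ) I :=
  fun a ha _ _ hab => Finset.sum_le_sum fun u hu =>
    csSup_le_csSup ((hbdd u hu).mono (image_mono inter_subset_left))
      ⟨_, a, ⟨ha, self_mem_Iic⟩, rfl⟩
      (image_mono (inter_subset_inter_right _ (Iic_subset_Iic.2 hab)))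

lemma abs_pastExtent_le {N : Finset ℂ} {I : Set ℝ} {γ : ℝ → ℂ} {R : ℝ}
    (hR : ∀ u ∈ N, ∀ t ∈ I, |⟪u, γ t⟫| ≤ R) {τ : ℝ} (hτ : τ ∈ I) :
    |pastExtent N I γ τ| ≤ N.card * R := by
  rw [← nsmul_eq_mul]
  refine (Finset.abs_sum_le_sum_abs _ _).trans (Finset.sum_le_card_nsmul _ _ _ fun u hu => ?_)
  rw [abs_le]
  have hmem : ⟪u, γ τ⟫ ∈ (fun t => ⟪u, γ t⟫) '' (I ∩ Iic τ) := ⟨τ, ⟨hτ, self_mem_Iic⟩, rfl⟩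
  have hub : R ∈ upperBounds ((fun t => ⟪u, γ t⟫) '' (I ∩ Iic τ)) := by
    rintro _ ⟨t, ht, rfl⟩
    exact (abs_le.1 (hR u hu t ht.1)).2
  exact ⟨(abs_le.1 (hR u hu τ hτ)).1.trans (le_csSup ⟨R, hub⟩ hmem), csSup_le ⟨_, hmem⟩ hub⟩

/-- If a continuous function moves, shortly after every time, by at most the increase of a
monotone function, then this also holds globally. -/
lemma norm_sub_le_sub_of_forall_exists_gt {E : Type*} [SeminormedAddCommGroup E] {f : ℝ → E}
    {F : ℝ → ℝ} {a b : ℝ} (hab : a ≤ b) (hf : ContinuousOn f (Icc a b))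
    (hF : MonotoneOn F (Icc a b))
    (hstep : ∀ x ∈ Ico a b, ∃ y ∈ Ioc x b, ‖f y - f x‖ ≤ F y - F x) :
    ‖f b - f a‖ ≤ F b - F a := by
  set G := {x ∈ Icc a b | ‖f x - f a‖ ≤ F x - F a} with hG
  have haG : a ∈ G := ⟨left_mem_Icc.2 hab, by simp⟩
  have hbdd : BddAbove G := ⟨b, fun x hx => hx.1.2⟩
  have hcmem : sSup G ∈ Icc a b := ⟨le_csSup hbdd haG, csSup_le ⟨a, haG⟩ fun x hx => hx.1.2⟩
  have hclosed : IsClosed (Icc a b ∩ (fun x => ‖f x - f a‖) ⁻¹' Iic (F (sSup G) - F a)) :=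
    (hf.sub continuousOn_const).norm.preimage_isClosed_of_isClosed isClosed_Icc isClosed_Iic
  have hsub : G ⊆ Icc a b ∩ (fun x => ‖f x - f a‖) ⁻¹' Iic (F (sSup G) - F a) := fun x hx =>
    ⟨hx.1, hx.2.trans (sub_le_sub_right (hF hx.1 hcmem (le_csSup hbdd hx)) _)⟩
  have hc : ‖f (sSup G) - f a‖ ≤ F (sSup G) - F a :=
    (closure_minimal hsub hclosed (csSup_mem_closure ⟨a, haG⟩ hbdd)).2
  rcases hcmem.2.eq_or_lt with hcb | hcb
  · rwa [hcb] at hc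
  · obtain ⟨y, hy, hyc⟩ := hstep _ ⟨hcmem.1, hcb⟩
    have hyG : y ∈ G := ⟨⟨hcmem.1.trans hy.1.le, hy.2⟩, by
      linarith [norm_sub_le_norm_sub_add_norm_sub (f y) (f (sSup G)) (f a)]⟩
    exact absurd (le_csSup hbdd hyG) hy.1.not_ge

lemma eVariationOn_lt_top_of_norm_sub_le {E : Type*} [SeminormedAddCommGroup E] {f : ℝ → E}
    {F : ℝ → ℝ} {I : Set ℝ} {B : ℝ} (hB : ∀ x ∈ I, |F x| ≤ B)
    (hf : ∀ a ∈ I, ∀ b ∈ I, a ≤ b → ‖f b - f a‖ ≤ F b - F a) : eVariationOn f I < ⊤ := by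
  refine lt_of_le_of_lt (iSup_le ?_) (ENNReal.ofReal_lt_top (r := 2 * B))
  rintro ⟨n, u, hu, huI⟩
  have hle : ∀ i, ‖f (u (i + 1)) - f (u i)‖ ≤ F (u (i + 1)) - F (u i) := fun i =>
    hf _ (huI i) _ (huI (i + 1)) (hu i.le_succ)
  calc ∑ i ∈ Finset.range n, edist (f (u (i + 1))) (f (u i))
      ≤ ∑ i ∈ Finset.range n, ENNReal.ofReal (F (u (i + 1)) - F (u i)) :=
        Finset.sum_le_sum fun i _ => by
          rw [edist_dist, dist_eq_norm]
          exact ENNReal.ofReal_le_ofReal (hle i)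
    _ = ENNReal.ofReal (F (u n) - F (u 0)) := by
        rw [← ENNReal.ofReal_sum_of_nonneg fun i _ => (norm_nonneg _).trans (hle i),
          Finset.sum_range_sub (fun i => F (u i))]
    _ ≤ ENNReal.ofReal (2 * B) := by
        refine ENNReal.ofReal_le_ofReal ?_
        linarith [(abs_le.1 (hB _ (huI n))).2, (abs_le.1 (hB _ (huI 0))).1]

/-- An injective planar eel with bounded image has finite length. -/
lemma IsPlanarEel_s19.eVariationOn_lt_top {lam : ℝ} {I : Set ℝ} {γ γ' : ℝ → ℂ}
    (h : IsPlanarEel_s19 lam I γ γ') (hlam₁ : -1 ≤ lam) (hlam₂ : lam < 1)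
    (hbdd : Bornology.IsBounded (γ '' I)) : eVariationOn γ I < ⊤ := by
  set κ := Real.cos (Real.arccos (-lam) / 2) / 2 with hκ
  set μ := (1 + lam) / 2 with hμ
  have hκ0 : 0 < κ := by
    have h1 : Real.arccos (-lam) < Real.pi :=
      lt_of_le_of_ne (Real.arccos_le_pi _) fun e => by
        have := Real.arccos_eq_pi.1 e
        linarith
    have := Real.cos_pos_of_mem_Ioo (x := Real.arccos (-lam) / 2)
      ⟨by linarith [Real.arccos_nonneg (-lam), Real.pi_pos], by linarith⟩
    positivity
  have hq : 0 < Real.sqrt (1 - μ ^ 2) := Real.sqrt_pos.2 (by nlinarith)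
  set c := κ * Real.sqrt (1 - μ ^ 2) with hc
  have hc0 : 0 < c := mul_pos hκ0 hq
  obtain ⟨N, hNs, hNfin, hN⟩ := finite_cover_balls_of_compact (isCompact_sphere (0 : ℂ) 1) hκ0
  lift N to Finset ℂ using hNfin
  have hN' : ∀ v : ℂ, ‖v‖ = 1 → ∃ u ∈ N, ‖v - u‖ ≤ κ := by
    intro v hv
    obtain ⟨u, hu, hvu⟩ := mem_iUnion₂.1 (hN (mem_sphere_zero_iff_norm.2 hv))
    exact ⟨u, hu, (mem_ball_iff_norm.1 hvu).le⟩
  obtain ⟨R, hR⟩ := hbdd.exists_norm_le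
  have hinner : ∀ u ∈ N, ∀ t ∈ I, |⟪u, γ t⟫| ≤ R := by
    intro u hu t ht
    have := abs_real_inner_le_norm u (γ t)
    rw [mem_sphere_zero_iff_norm.1 (hNs hu), one_mul] at this
    exact this.trans (hR _ ⟨t, ht, rfl⟩)
  have habove : ∀ u ∈ N, BddAbove ((fun t => ⟪u, γ t⟫) '' I) := by
    intro u hu
    refine ⟨R, ?_⟩
    rintro _ ⟨t, ht, rfl⟩
    exact (abs_le.1 (hinner u hu t ht)).2
  have hmono := monotoneOn_pastExtent habove
  refine eVariationOn_lt_top_of_norm_sub_le (F := fun x => pastExtent N I γ x / c)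
    (B := N.card * R / c) (fun x hx => ?_) fun a ha b hb hab => ?_
  · rw [abs_div, abs_of_pos hc0]
    exact div_le_div_of_nonneg_right (abs_pastExtent_le hinner hx) hc0.le
  · have hsub : Icc a b ⊆ I := h.ordConnected.out ha hb
    refine norm_sub_le_sub_of_forall_exists_gt (F := fun x => pastExtent N I γ x / c) hab
      (h.continuousOn.mono hsub)
      (fun x hx y hy hxy => div_le_div_of_nonneg_right (hmono (hsub hx) (hsub hy) hxy) hc0.le)
      fun x hx => ?_
    obtain ⟨y, hy, hyx⟩ := h.exists_mul_norm_sub_le_pastExtent_sub hlam₂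
      (show lam < μ by linarith) le_rfl hκ0.le hN' habove
      (hsub (Ico_subset_Icc_self hx)) hb hx.2
    refine ⟨y, hy, ?_⟩
    rw [← sub_div, le_div_iff₀ hc0, mul_comm]
    exact hyx

/-- **bounded planar eels have finite length.** Every injective `λ`-eel
`γ : I → ℝ²` with bounded image has finite length. -/
theorem planar_lambda_eel_finite_length (lam : ℝ) (hlam₁ : -1 ≤ lam) (hlam₂ : lam < 1)
    (I : Set ℝ) (hI : I.OrdConnected)
    (γ γ' : ℝ → EuclideanSpace ℝ (Fin 2))
    (hcont : ContinuousOn γ I)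
    (hderiv : ∀ τ ∈ I, HasDerivWithinAt γ (γ' τ) (I ∩ Set.Ici τ) τ)
    (hne : ∀ τ ∈ I, γ' τ ≠ 0)
    (heel : ∀ t ∈ I, ∀ τ ∈ I, t < τ →
      ⟪γ' τ, γ t - γ τ⟫ ≤ lam * ‖γ' τ‖ * ‖γ t - γ τ‖)
    (hinj : Set.InjOn γ I)
    (hbdd : Bornology.IsBounded (γ '' I)) :
    eVariationOn γ I < ⊤ := by
  set e := Complex.orthonormalBasisOneI.repr.symm with he
  have h : IsPlanarEel_s19 lam I (fun t => e (γ t)) (fun t => e (γ' t)) :=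
    { ordConnected := hI
      continuousOn := e.continuous.comp_continuousOn hcont
      hasDerivWithinAt := fun τ hτ =>
        e.toContinuousLinearEquiv.hasFDerivAt.comp_hasDerivWithinAt τ (hderiv τ hτ)
      deriv_ne_zero := fun τ hτ => by simpa using hne τ hτ
      inner_le := fun t ht τ hτ htτ => by
        simpa only [← map_sub, LinearIsometryEquiv.inner_map_map, LinearIsometryEquiv.norm_map]
          using heel t ht τ hτ htτ
      injOn := fun x hx y hy hxy => hinj hx hy (e.injective hxy) }
  have hvar := h.eVariationOn_lt_top hlam₁ hlam₂ (by
    have := e.lipschitz.isBounded_image hbdd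
    rwa [image_image] at this)
  simpa only [eVariationOn, e.edist_map] using hvar
end
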